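/- arXiv:2109.03270 — 4 statements merged into one kernel-verified Lean document; each statement's English description precedes it below -/
import Mathlib

section
/- Let γ>0, μ>−1/2, 0≤a≤2 and t≥0. Define the weight w̄_{γ,μ}(y)=(1+|y|)^{1+2γ} for y≥0 and w̄_{γ,μ}(y)=(1+|y|)^{−2μ} for y<0. Then there is a constant C_{γ,μ}, depending only on γ and μ, such that for every continuously differentiable function φ:[0,∞)→ℝ with r^{γ}φ(r)→0 as r→∞ and for which the right-hand side below is finite, one has ∫₀^∞ |φ(r)|² w̄_{γ,μ}(r−t)(1+|r−t|)^{−2}(1+t+r)^{−a} r² dr ≤ C_{γ,μ} ∫₀^∞ |φ′(r)|² w̄_{γ,μ}(r−t)(1+t+r)^{−a} r² dr. -/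
noncomputable section
open MeasureTheory

/-- The weight `w̄_{γ,μ}`: `(1+|y|)^{1+2γ}` for `y ≥ 0` and `(1+|y|)^{-2μ}` for `y < 0`. -/
def wbar (γ μ : ℝ) (y : ℝ) : ℝ :=
  if 0 ≤ y then (1 + |y|) ^ (1 + 2*γ) else (1 + |y|) ^ (-(2*μ))

open Set Filter Topology in
lemma wp_abstract (t c : ℝ) (ht : 0 ≤ t) (hc : 0 < c) (D p φ : ℝ → ℝ)
    (hD : ContinuousOn D (Ici 0)) (hp : ContinuousOn p (Ici 0))
    (hDpos : ∀ r, 0 < r → 0 < D r) (hD0 : ∀ r, 0 ≤ r → 0 ≤ D r) (hD00 : D 0 = 0)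
    (hppos : ∀ r, 0 < p r)
    (hG : ∀ r, 0 < r → r ≠ t → ∃ G', HasDerivAt (fun x => D x * p x) G' r ∧ c * D r ≤ G')
    (hφ : ContDiffOn ℝ 1 φ (Ici 0)) (hφ0 : Tendsto φ atTop (𝓝 0))
    (hI : IntegrableOn (fun r => (deriv φ r)^2 * (D r * (p r)^2)) (Ioi 0)) :
    ∫ r in Ioi (0:ℝ), (φ r)^2 * D r ≤
      (4/c^2) * ∫ r in Ioi (0:ℝ), (deriv φ r)^2 * (D r * (p r)^2) := by
  set v : ℝ → ℝ := fun r => (deriv φ r)^2 * (D r * (p r)^2) with hv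
  set w : ℝ → ℝ := fun r => (φ r)^2 * D r with hw
  have hv0 : ∀ r ∈ Ioi (0:ℝ), 0 ≤ v r := fun r hr => by
    have := hDpos r hr
    simp only [hv]; positivity
  have hw0 : ∀ r ∈ Ioi (0:ℝ), 0 ≤ w r := fun r hr => by
    have := hDpos r hr
    simp only [hw]; positivity
  set L := ∫ r in Ioi (0:ℝ), v r with hL
  have hL0 : 0 ≤ L := setIntegral_nonneg measurableSet_Ioi hv0
  by_cases hint : IntegrableOn w (Ioi 0)
  swap
  · rw [integral_undef hint]; positivity
  have hφc : ContinuousOn φ (Ici 0) := hφ.continuousOn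
  have hφd : ∀ r, 0 < r → HasDerivAt φ (deriv φ r) r := fun r hr =>
    ((hφ.differentiableOn (by norm_num) r hr.le).differentiableAt (Ici_mem_nhds hr)).hasDerivAt
  have hφ'c : ContinuousOn (deriv φ) (Ioi 0) :=
    (hφ.mono Ioi_subset_Ici_self).continuousOn_deriv_of_isOpen isOpen_Ioi (by norm_num)
  have hvc : ContinuousOn v (Ioi 0) :=
    (hφ'c.pow 2).mul ((hD.mono Ioi_subset_Ici_self).mul ((hp.mono Ioi_subset_Ici_self).pow 2))
  have hwc : ContinuousOn w (Ioi 0) :=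
    ((hφc.mono Ioi_subset_Ici_self).pow 2).mul (hD.mono Ioi_subset_Ici_self)
  have key : ∀ f : ℝ → ℝ, IntegrableOn f (Ioi 0) → ContinuousOn f (Ioi 0) →
      (∀ r, 0 < r → HasDerivAt (fun x => ∫ y in (0:ℝ)..x, f y) (f r) r) ∧
      ContinuousOn (fun x => ∫ y in (0:ℝ)..x, f y) (Ici 0) ∧
      Tendsto (fun x => ∫ y in (0:ℝ)..x, f y) atTop (𝓝 (∫ y in Ioi 0, f y)) := by
    intro f hf hfc
    have hii : ∀ r, 0 ≤ r → IntervalIntegrable f volume 0 r := fun r hr => by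
      rw [intervalIntegrable_iff_integrableOn_Ioc_of_le hr]
      exact hf.mono_set Ioc_subset_Ioi_self
    refine ⟨fun r hr => ?_, ?_, ?_⟩
    · exact intervalIntegral.integral_hasDerivAt_right (hii r hr.le)
        (hfc.stronglyMeasurableAtFilter isOpen_Ioi r hr)
        (hfc.continuousAt (Ioi_mem_nhds hr))
    · intro x hx
      have hx' : (0:ℝ) ≤ x := hx
      have h1 : ContinuousOn (fun x => ∫ y in (0:ℝ)..x, f y) (Icc 0 (x+1)) := by
        have := intervalIntegral.continuousOn_primitive_interval (μ := volume) (f := f) (a := 0) (b := x+1)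
          (by rw [uIcc_of_le (by linarith), integrableOn_Icc_iff_integrableOn_Ioc]
              exact hf.mono_set Ioc_subset_Ioi_self)
        rwa [uIcc_of_le (by linarith)] at this
      have h2 := h1 x ⟨hx', by linarith⟩
      refine h2.mono_of_mem_nhdsWithin ?_
      have : Icc 0 (x+1) = Ici 0 ∩ Iic (x+1) := rfl
      rw [this]
      exact inter_mem self_mem_nhdsWithin (mem_nhdsWithin_of_mem_nhds (Iic_mem_nhds (by linarith)))
    · exact intervalIntegral_tendsto_integral_Ioi 0 hf tendsto_id
  obtain ⟨Id, Ic, It⟩ := key v hI hvc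
  obtain ⟨Jd, Jc, Jt⟩ := key w hint hwc
  set I : ℝ → ℝ := fun x => ∫ y in (0:ℝ)..x, v y with hIdef
  set J : ℝ → ℝ := fun x => ∫ y in (0:ℝ)..x, w y with hJdef
  -- energy monotonicity
  let F : ℝ → ℝ := fun r => D r * p r * (φ r)^2 + (2/c) * I r - (c/2) * J r
  have hFc : ContinuousOn F (Ici 0) := by
    apply ContinuousOn.sub
    · exact ((hD.mul hp).mul (hφc.pow 2)).add (continuousOn_const.mul Ic)
    · exact continuousOn_const.mul Jc
  have hFd : ∀ r, 0 < r → r ≠ t → ∃ F', HasDerivAt F F' r ∧ 0 ≤ F' := by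
    intro r hr hrt
    obtain ⟨G', hG', hle⟩ := hG r hr hrt
    refine ⟨_, ((hG'.mul ((hφd r hr).pow 2)).add ((Id r hr).const_mul (2/c))).sub
      ((Jd r hr).const_mul (c/2)), ?_⟩
    simp only [hv, hw]
    have h1 : c * D r * (φ r)^2 ≤ G' * (φ r)^2 := mul_le_mul_of_nonneg_right hle (sq_nonneg _)
    have h2 : 0 ≤ (2/c) * (D r * (c/2 * φ r + p r * deriv φ r)^2) := by
      have := hDpos r hr; positivity
    have h3 : (2/c) * (D r * (c/2 * φ r + p r * deriv φ r)^2) = (c/2) * (D r * (φ r)^2)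
      + 2 * (D r * p r * φ r * deriv φ r) + 2/c * (deriv φ r^2 * (D r * p r^2)) := by
      field_simp; ring
    simp only [Pi.pow_apply]
    norm_num
    nlinarith
  have mono : ∀ (H : ℝ → ℝ) (s : Set ℝ), Convex ℝ s → ContinuousOn H s →
      (∀ r ∈ interior s, ∃ H', HasDerivAt H H' r ∧ 0 ≤ H') → MonotoneOn H s := by
    intro H s hs hHc hH
    refine monotoneOn_of_deriv_nonneg hs hHc (fun r hr => ?_) (fun r hr => ?_)
    · obtain ⟨_, h, _⟩ := hH r hr
      exact h.differentiableAt.differentiableWithinAt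
    · obtain ⟨_, h, h'⟩ := hH r hr
      rwa [h.deriv]
  have hF1 : MonotoneOn F (Icc 0 t) := by
    refine mono F _ (convex_Icc _ _) (hFc.mono Icc_subset_Ici_self) (fun r hr => ?_)
    rw [interior_Icc] at hr
    exact hFd r hr.1 hr.2.ne
  have hF2 : MonotoneOn F (Ici t) := by
    refine mono F _ (convex_Ici _) (hFc.mono (Ici_subset_Ici.2 ht)) (fun r hr => ?_)
    rw [interior_Ici] at hr
    exact hFd r (ht.trans_lt hr) hr.ne'
  have hFnn : ∀ r, t ≤ r → 0 ≤ F r := by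
    intro r hr
    have h0 : F 0 = 0 := by simp [F, hIdef, hJdef, hD00]
    have h1 := hF1 (left_mem_Icc.2 ht) (right_mem_Icc.2 ht) ht
    have h2 := hF2 self_mem_Ici (mem_Ici.2 hr) hr
    linarith
  -- decay estimate
  have dec : ∀ (σ : ℝ), σ^2 = 1 → ∀ l : ℝ, 0 < l → ∀ R, t < R → 
      σ * φ R ≤ l/2 * (L - I R) + 1/(2*l*c) * (D R * p R)⁻¹ := by
    intro σ hσ l hl R hR
    let H : ℝ → ℝ := fun r => σ * φ r + l/2 * I r - 1/(2*l*c) * (D r * p r)⁻¹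
    have hHd : ∀ r, t < r → ∃ H', HasDerivAt H H' r ∧ 0 ≤ H' := by
      intro r hrt
      have hr : 0 < r := ht.trans_lt hrt
      obtain ⟨G', hG', hle⟩ := hG r hr hrt.ne'
      have hDr := hDpos r hr
      have hpr := hppos r
      refine ⟨_, (((hφd r hr).const_mul σ).add ((Id r hr).const_mul (l/2))).sub
        ((hG'.inv (by positivity)).const_mul (1/(2*l*c))), ?_⟩
      simp only [hv]
      have h1 : 1/(2*l*c) * (-G' / (D r * p r)^2) ≤ 1/(2*l*c) * (-(c * D r) / (D r * p r)^2) := by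
        gcongr
      have h2 : 1/(2*l*c) * (-(c * D r) / (D r * p r)^2) = - (1/(2 * l * (D r * p r^2))) := by
        field_simp
      have h3 : 0 ≤ 1/(2 * l * (D r * p r^2)) * (σ + l * (D r * p r^2) * deriv φ r)^2 := by
        positivity
      have h4 : 1/(2 * l * (D r * p r^2)) * (σ + l * (D r * p r^2) * deriv φ r)^2
        = 1/(2 * l * (D r * p r^2)) * σ^2 + σ * deriv φ r + l/2 * (deriv φ r^2 * (D r * p r^2)) := by
        field_simp; ring
      rw [hσ] at h4
      linarith
    have hHm : MonotoneOn H (Ici R) := by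
      refine mono H _ (convex_Ici _) (fun r hr => ?_) (fun r hr => ?_)
      · obtain ⟨_, h, _⟩ := hHd r (hR.trans_le hr)
        exact h.continuousAt.continuousWithinAt
      · rw [interior_Ici] at hr
        exact hHd r (hR.trans hr)
    have hlim : Tendsto (fun r => σ * φ r + l/2 * I r) atTop (𝓝 (σ * 0 + l/2 * L)) :=
      (hφ0.const_mul σ).add (It.const_mul (l/2))
    have : H R ≤ σ * 0 + l/2 * L := by
      refine ge_of_tendsto hlim ?_
      filter_upwards [eventually_ge_atTop R] with r hr
      have h1 := hHm self_mem_Ici (mem_Ici.2 hr) hr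
      have h2 : 0 ≤ 1/(2*l*c) * (D r * p r)⁻¹ := by
        have := hDpos r (by linarith)
        have := hppos r
        positivity
      have : H r = σ * φ r + l/2 * I r - 1/(2*l*c) * (D r * p r)⁻¹ := rfl
      linarith
    have h3 : H R = σ * φ R + l/2 * I R - 1/(2*l*c) * (D R * p R)⁻¹ := rfl
    linarith
  set K := 1/2 + 1/(2*c) with hK
  have hKpos : 0 < K := by positivity
  have bd : ∀ s : ℝ, 0 < s → ∀ᶠ R in atTop, D R * p R * (φ R)^2 ≤ (s * K)^2 := by
    intro s hs
    have hev : ∀ᶠ R in atTop, L - s^2 < I R := It.eventually (lt_mem_nhds (by nlinarith))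
    filter_upwards [hev, eventually_gt_atTop t] with R hR hRt
    have hDr := hDpos R (by linarith)
    have hpr := hppos R
    obtain ⟨g, hg, hgg⟩ : ∃ g, 0 < g ∧ D R * p R = g^2 :=
      ⟨√(D R * p R), by positivity, (Real.sq_sqrt (by positivity)).symm⟩
    rw [hgg]
    have hl : ∀ σ : ℝ, σ^2 = 1 → σ * (g * φ R) ≤ s * K := by
      intro σ hσ
      have h := dec σ hσ (1/(s*g)) (by positivity) R hRt
      rw [hgg] at h
      have h' : (1/(s*g))/2 * (L - I R) ≤ (1/(s*g))/2 * s^2 := by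
        gcongr; linarith
      have h2 := mul_le_mul_of_nonneg_left (h.trans (add_le_add_left h' _)) hg.le
      have h3 : g * ((1/(s*g))/2 * s^2 + 1/(2*(1/(s*g))*c) * (g^2)⁻¹) = s * K := by
        rw [hK]; field_simp
      linarith
    have e1 := hl 1 (by norm_num)
    have e2 := hl (-1) (by norm_num)
    rw [← mul_pow]
    exact sq_le_sq' (by linarith) (by linarith)
  have fin : ∀ s : ℝ, 0 < s → c/2 * (∫ r in Ioi (0:ℝ), w r) ≤ (s*K)^2 + 2/c * L := by
    intro s hs
    refine le_of_tendsto_of_tendsto (Jt.const_mul (c/2))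
      ((tendsto_const_nhds (x := (s*K)^2)).add (It.const_mul (2/c))) ?_
    filter_upwards [bd s hs, eventually_ge_atTop t] with R h1 h2
    have h3 := hFnn R h2
    have h4 : F R = D R * p R * (φ R)^2 + (2/c) * I R - (c/2) * J R := rfl
    linarith
  have fin2 : c/2 * (∫ r in Ioi (0:ℝ), w r) ≤ 2/c * L := by
    refine le_of_forall_pos_le_add (fun e he => ?_)
    have h := fin (√e / K) (by positivity)
    rw [div_mul_cancel₀ _ hKpos.ne', Real.sq_sqrt he.le] at h
    linarith
  have h5 := mul_le_mul_of_nonneg_left fin2 (show 0 ≤ 2/c by positivity)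
  have h6 : 2/c * (c/2 * (∫ r in Ioi (0:ℝ), w r)) = ∫ r in Ioi (0:ℝ), w r := by field_simp
  have h7 : 2/c * (2/c * L) = 4/c^2 * L := by field_simp; ring
  linarith

lemma wp_local (σ k a t r : ℝ) (hσ : σ^2 = 1) (ha0 : 0 ≤ a) (ha : a ≤ 2) (ht : 0 ≤ t) (hr : 0 < r)
    (hq : 0 < 1 + σ * (r - t)) :
    ∃ G', HasDerivAt (fun x => (1 + σ * (x - t)) ^ (σ * k) * (1 + t + x) ^ (-a) * x ^ 2) G' r ∧
      k * ((1 + σ * (r - t)) ^ (σ * k - 1) * (1 + t + r) ^ (-a) * r ^ 2) ≤ G' := by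
  have hs : 0 < 1 + t + r := by linarith
  have d1 : HasDerivAt (fun x => 1 + σ * (x - t)) (σ * 1) r :=
    (((hasDerivAt_id r).sub_const t).const_mul σ).const_add 1
  have d2 : HasDerivAt (fun x : ℝ => 1 + t + x) 1 r := (hasDerivAt_id r).const_add (1 + t)
  have e1 := d1.rpow_const (p := σ * k) (Or.inl hq.ne')
  have e2 := d2.rpow_const (p := -a) (Or.inl hs.ne')
  have e3 := hasDerivAt_pow 2 r
  refine ⟨_, (e1.mul e2).mul e3, ?_⟩
  have f2 : (1 + t + r) ^ (-a) = (1 + t + r) ^ (-a - 1) * (1 + t + r) := by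
    rw [Real.rpow_sub_one hs.ne']; field_simp
  have p1 : 0 < (1 + σ * (r - t)) ^ (σ * k) := Real.rpow_pos_of_pos hq _
  have p2 : 0 < (1 + t + r) ^ (-a - 1) := Real.rpow_pos_of_pos hs _
  simp only [Pi.mul_apply]
  rw [f2]
  set A := (1 + σ * (r - t)) ^ (σ * k)
  set A' := (1 + σ * (r - t)) ^ (σ * k - 1)
  set B := (1 + t + r) ^ (-a - 1)
  have h : 0 ≤ A * B * r * (2 * (1 + t + r) - a * r) := by
    have : 0 ≤ 2 * (1 + t + r) - a * r := by nlinarith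
    positivity
  have h2 : σ * 1 * (σ * k) = k := by linear_combination k * hσ
  rw [h2]
  norm_num
  nlinarith

lemma wbar_nonneg_eq (γ μ y : ℝ) (hy : 0 ≤ y) : wbar γ μ y = (1 + y) ^ (1 + 2*γ) := by
  simp [wbar, hy, abs_of_nonneg hy]

lemma wbar_neg_eq (γ μ y : ℝ) (hy : y < 0) : wbar γ μ y = (1 - y) ^ (-(2*μ)) := by
  simp [wbar, not_le.2 hy, abs_of_neg hy, sub_eq_add_neg]

lemma wbar_cont (γ μ : ℝ) : Continuous (wbar γ μ) := by
  unfold wbar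
  have h : ∀ y : ℝ, 1 + |y| ≠ 0 := fun y => by positivity
  refine Continuous.if_le ?_ ?_ continuous_const continuous_id ?_
  · exact (by fun_prop : Continuous fun y : ℝ => 1 + |y|).rpow_const (fun y => Or.inl (h y))
  · exact (by fun_prop : Continuous fun y : ℝ => 1 + |y|).rpow_const (fun y => Or.inl (h y))
  · intro y hy
    simp [← hy]

lemma wbar_pos (γ μ y : ℝ) : 0 < wbar γ μ y := by
  unfold wbar; split_ifs <;> positivity

/-- **Weighted 1-d Poincaré/Hardy inequality** (Lemma 8.3).  For `γ > 0`, `μ > -1/2` there is a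
constant `C = C_{γ,μ}` such that for all `0 ≤ a ≤ 2`, `t ≥ 0` and all `C¹` functions
`φ : [0,∞) → ℝ` with `r^γ φ(r) → 0` as `r → ∞` and finite right-hand side,
`∫₀^∞ φ² w̄(r-t) (1+|r-t|)⁻² (1+t+r)^{-a} r² dr ≤ C ∫₀^∞ (φ')² w̄(r-t) (1+t+r)^{-a} r² dr`. -/
theorem weighted_poincare_1d (γ μ : ℝ) (hγ : 0 < γ) (hμ : -(1/2) < μ) :
    ∃ C : ℝ, 0 < C ∧
      ∀ (a t : ℝ), 0 ≤ a → a ≤ 2 → 0 ≤ t →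
      ∀ φ : ℝ → ℝ, ContDiffOn ℝ 1 φ (Set.Ici 0) →
        Filter.Tendsto (fun r => r ^ γ * φ r) Filter.atTop (nhds 0) →
        IntegrableOn
          (fun r => (deriv φ r)^2 * wbar γ μ (r - t) * (1 + t + r) ^ (-a) * r^2)
          (Set.Ioi 0) →
        ∫ r in Set.Ioi (0:ℝ),
            (φ r)^2 * wbar γ μ (r - t) * ((1 + |r - t|)^2)⁻¹ * (1 + t + r) ^ (-a) * r^2
          ≤ C * ∫ r in Set.Ioi (0:ℝ),
            (deriv φ r)^2 * wbar γ μ (r - t) * (1 + t + r) ^ (-a) * r^2 := by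
  have hc : 0 < min (2*γ) (2*μ+1) := lt_min (by linarith) (by linarith)
  refine ⟨4 / (min (2*γ) (2*μ+1))^2, by positivity, ?_⟩
  intro a t ha0 ha ht φ hφ hlim hint
  have hφ0 : Filter.Tendsto φ Filter.atTop (nhds 0) := by
    have h := (tendsto_rpow_neg_atTop hγ).mul hlim
    rw [mul_zero] at h
    refine h.congr' ?_
    filter_upwards [Filter.eventually_gt_atTop 0] with r hr
    rw [← mul_assoc, ← Real.rpow_add hr]; simp
  have hp : ∀ r : ℝ, 0 < 1 + |r - t| := fun r => by positivity
  have e1 : ∀ r, (deriv φ r)^2 * wbar γ μ (r - t) * (1 + t + r) ^ (-a) * r^2 =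
      (deriv φ r)^2 * ((wbar γ μ (r - t) * ((1 + |r - t|)^2)⁻¹ * (1 + t + r) ^ (-a) * r^2)
        * (1 + |r - t|)^2) := fun r => by
    have := hp r
    field_simp
  have e2 : ∀ r, (φ r)^2 * wbar γ μ (r - t) * ((1 + |r - t|)^2)⁻¹ * (1 + t + r) ^ (-a) * r^2 =
      (φ r)^2 * (wbar γ μ (r - t) * ((1 + |r - t|)^2)⁻¹ * (1 + t + r) ^ (-a) * r^2) :=
    fun r => by ring
  simp only [e1] at hint ⊢
  simp only [e2]
  have hDpos : ∀ r : ℝ, 0 < r →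
      0 < wbar γ μ (r - t) * ((1 + |r - t|)^2)⁻¹ * (1 + t + r) ^ (-a) * r^2 := fun r hr => by
    have := wbar_pos γ μ (r - t)
    positivity
  refine wp_abstract t (min (2*γ) (2*μ+1)) ht hc
    (fun r => wbar γ μ (r - t) * ((1 + |r - t|)^2)⁻¹ * (1 + t + r) ^ (-a) * r^2)
    (fun r => 1 + |r - t|) φ ?_ (by fun_prop) hDpos ?_ (by simp) hp ?_ hφ hφ0 hint
  · have c1 : Continuous fun r => wbar γ μ (r - t) := (wbar_cont γ μ).comp (by fun_prop)
    have c2 : Continuous fun r : ℝ => ((1 + |r - t|)^2)⁻¹ :=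
      Continuous.inv₀ (by fun_prop) (fun r => (pow_pos (hp r) 2).ne')
    have c3 : ContinuousOn (fun r : ℝ => (1 + t + r) ^ (-a)) (Set.Ici 0) :=
      ContinuousOn.rpow_const (by fun_prop) (fun r hr => Or.inl (by
        have : (0:ℝ) ≤ r := hr
        positivity))
    exact (((c1.mul c2).continuousOn).mul c3).mul (by fun_prop)
  · intro r hr
    rcases hr.eq_or_lt with h | h
    · simp [← h]
    · exact (hDpos r h).le
  · intro r hr hrt
    rcases lt_or_gt_of_ne hrt with h | h
    · have hq : 0 < 1 + (-1) * (r - t) := by linarith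
      obtain ⟨G', h1, h2⟩ := wp_local (-1) (2*μ+1) a t r (by norm_num) ha0 ha ht hr hq
      refine ⟨G', h1.congr_of_eventuallyEq ?_, le_trans ?_ h2⟩
      · filter_upwards [Iio_mem_nhds h] with x hx
        have hx' : x < t := hx
        have hqx : 0 < 1 + (-1) * (x - t) := by linarith
        rw [wbar_neg_eq _ _ _ (by linarith), abs_of_neg (by linarith)]
        have s1 : (-1) * (2*μ+1) = -(2*μ) - 1 := by ring
        have s2 : 1 - (x - t) = 1 + (-1) * (x - t) := by ring
        have s3 : 1 + -(x - t) = 1 + (-1) * (x - t) := by ring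
        rw [s1, s2, s3, Real.rpow_sub_one hqx.ne']
        generalize 1 + (-1) * (x - t) = q at *
        field_simp
      · rw [wbar_neg_eq _ _ _ (by linarith), abs_of_neg (by linarith)]
        have s1 : (-1) * (2*μ+1) - 1 = -(2*μ) - 1 - 1 := by ring
        have s2 : 1 - (r - t) = 1 + (-1) * (r - t) := by ring
        have s3 : 1 + -(r - t) = 1 + (-1) * (r - t) := by ring
        rw [s1, s2, s3, Real.rpow_sub_one hq.ne', Real.rpow_sub_one hq.ne']
        generalize 1 + (-1) * (r - t) = q at *
        have s4 : q ^ (-(2*μ)) / q / q = q ^ (-(2*μ)) * (q^2)⁻¹ := by field_simp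
        rw [s4]
        have hs : 0 < 1 + t + r := by linarith
        exact mul_le_mul_of_nonneg_right (min_le_right _ _) (by positivity)
    · have hq : 0 < 1 + 1 * (r - t) := by linarith
      obtain ⟨G', h1, h2⟩ := wp_local 1 (2*γ) a t r (by norm_num) ha0 ha ht hr hq
      refine ⟨G', h1.congr_of_eventuallyEq ?_, le_trans ?_ h2⟩
      · filter_upwards [Ioi_mem_nhds h] with x hx
        have hx' : t < x := hx
        have hqx : 0 < 1 + 1 * (x - t) := by linarith
        rw [wbar_nonneg_eq _ _ _ (by linarith), abs_of_pos (by linarith)]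
        have s1 : 1 * (2*γ) = (1 + 2*γ) - 1 := by ring
        have s2 : 1 + (x - t) = 1 + 1 * (x - t) := by ring
        rw [s1, s2, Real.rpow_sub_one hqx.ne']
        generalize 1 + 1 * (x - t) = q at *
        field_simp
      · rw [wbar_nonneg_eq _ _ _ (by linarith), abs_of_pos (by linarith)]
        have s1 : 1 * (2*γ) - 1 = (1 + 2*γ) - 1 - 1 := by ring
        have s2 : 1 + (r - t) = 1 + 1 * (r - t) := by ring
        rw [s1, s2, Real.rpow_sub_one hq.ne', Real.rpow_sub_one hq.ne']
        generalize 1 + 1 * (r - t) = q at *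
        have s4 : q ^ (1 + 2*γ) / q / q = q ^ (1 + 2*γ) * (q^2)⁻¹ := by field_simp
        rw [s4]
        have hs : 0 < 1 + t + r := by linarith
        exact mul_le_mul_of_nonneg_right (min_le_left _ _) (by positivity)
end
end

section
/- Let 0<μ<1/2 and ε₀>0. Suppose the smooth symmetric-matrix-valued function H^{ab} on ℝ^{1+3} satisfies, for all (t,x): |H|+⟨t−r⟩|∂H|+⟨t+r⟩|∂̄H| ≤ ε₀⟨t−r⟩^{1/2−μ}⟨t+r⟩^{−1/2−μ}, and |H|_{LL}+⟨t−r⟩|∂H|_{LL}+⟨t+r⟩|∂̄H|_{LL} ≤ ε₀⟨t−r⟩⟨t+r⟩^{−1−2μ}, where |H|_{LL}=|H^{ab}L_aL_b|, |∂H|_{LL}=Σ_{U∈𝒩}|U^aL_bL_c∂_aH^{bc}|, |∂̄H|_{LL}=Σ_{U∈𝒯}|U^aL_bL_c∂_aH^{bc}|. Then there is a constant C, depending only on μ, such that for every C¹ function φ on ℝ^{1+3}: |∂_tH^{ab}∂_aφ∂_bφ| ≤ Cε₀(⟨t+r⟩^{−1−2μ}|∂φ|² + ⟨t−r⟩^{−1/2−μ}⟨t+r⟩^{−1/2−μ}|∂̄φ||∂φ|),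 and |∂_aH^{ab}∂_bφ| ≤ Cε₀(⟨t+r⟩^{−1−2μ}|∂φ| + ⟨t−r⟩^{−1/2−μ}⟨t+r⟩^{−1/2−μ}|∂̄φ|). -/
noncomputable section
open MeasureTheory

abbrev E3 : Type := EuclideanSpace ℝ (Fin 3)
abbrev Spt : Type := ℝ × E3

/-- The coordinate basis directions of `ℝ^{1+3}`. -/
def dir (a : Fin 4) : Spt :=
  Fin.cases ((1:ℝ), (0:E3)) (fun i => ((0:ℝ), EuclideanSpace.single i (1:ℝ))) a

/-- Coordinate partial derivative `∂_a`. -/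
def pd (a : Fin 4) (f : Spt → ℝ) (p : Spt) : ℝ := fderiv ℝ f p (dir a)

def toVec (c : Fin 4 → ℝ) : Spt := ∑ a : Fin 4, c a • dir a

/-- The japanese bracket `⟨s⟩ = 1 + |s|`. -/
def jap (s : ℝ) : ℝ := 1 + |s|

/-- ω = x/|x| -/
def omg (p : Spt) : E3 := ‖p.2‖⁻¹ • p.2

def Ldir (p : Spt) : Spt := ((1:ℝ), omg p)
def Lbardir (p : Spt) : Spt := ((1:ℝ), -omg p)
def qdir (p : Spt) : Spt := (-(1:ℝ)/2, (2⁻¹:ℝ) • omg p)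
def angDir (i : Fin 3) (p : Spt) : Spt :=
  ((0:ℝ), EuclideanSpace.single i (1:ℝ) - omg p i • omg p)

/-- The Minkowski metric (= its inverse) `diag(-1,1,1,1)`. -/
def eta (a b : Fin 4) : ℝ := if a = b then (if a = 0 then -1 else 1) else 0

def Llow (p : Spt) (a : Fin 4) : ℝ := Fin.cases (-1:ℝ) (fun i => omg p i) a
def Lup (p : Spt) (a : Fin 4) : ℝ := Fin.cases (1:ℝ) (fun i => omg p i) a
def Lbarlow (p : Spt) (a : Fin 4) : ℝ := Fin.cases (-1:ℝ) (fun i => -omg p i) a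
def Lbarup (p : Spt) (a : Fin 4) : ℝ := Fin.cases (1:ℝ) (fun i => -omg p i) a

/-- Index type for the Minkowski commuting vector fields: translations,
rotations/boosts, scaling. -/
abbrev ZIdx : Type := Fin 4 ⊕ (Fin 4 × Fin 4) ⊕ Unit

def xlow (p : Spt) (a : Fin 4) : ℝ := Fin.cases (-p.1) (fun i => p.2 i) a
def xup (p : Spt) (a : Fin 4) : ℝ := Fin.cases p.1 (fun i => p.2 i) a

/-- The components of the Minkowski commuting vector fields. -/
def zfield : ZIdx → Spt → Fin 4 → ℝ
  | Sum.inl a => fun _ c => if c = a then 1 else 0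
  | Sum.inr (Sum.inl ab) => fun p c =>
      xlow p ab.1 * (if c = ab.2 then 1 else 0) - xlow p ab.2 * (if c = ab.1 then 1 else 0)
  | Sum.inr (Sum.inr _) => fun p => xup p

/-- `Z^I` applied to a scalar function. -/
def zApply : {k : ℕ} → (Fin k → ZIdx) → (Spt → ℝ) → Spt → ℝ
  | 0, _, f => f
  | _+1, I, f => fun p => fderiv ℝ (zApply (fun j => I j.succ) f) p (toVec (zfield (I 0) p))

/-- `∂^β` applied to a scalar function. -/
def pdT : {k : ℕ} → (Fin k → Fin 4) → (Spt → ℝ) → Spt → ℝ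
  | 0, _, f => f
  | _+1, β, f => pd (β 0) (pdT (fun j => β j.succ) f)

def pdd (a b : Fin 4) (f : Spt → ℝ) : Spt → ℝ := pd a (pd b f)

/-- The flat wave operator `□ = -∂_t² + Δ`. -/
def box (f : Spt → ℝ) (p : Spt) : ℝ := -(pdd 0 0 f p) + ∑ i : Fin 3, pdd i.succ i.succ f p


/-- Directional derivative of a component of a (2,0)-tensor field. -/
def mder (H : Spt → Fin 4 → Fin 4 → ℝ) (v : Spt) (p : Spt) (a b : Fin 4) : ℝ :=
  fderiv ℝ (fun q => H q a b) p v

/-- `|H|`: sum of absolute values of all components. -/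
def nH (H : Spt → Fin 4 → Fin 4 → ℝ) (p : Spt) : ℝ := ∑ a : Fin 4, ∑ b : Fin 4, |H p a b|

/-- `|∂H|`: sum of all coordinate derivatives of all components. -/
def nDH (H : Spt → Fin 4 → Fin 4 → ℝ) (p : Spt) : ℝ :=
  ∑ c : Fin 4, ∑ a : Fin 4, ∑ b : Fin 4, |mder H (dir c) p a b|

/-- `|∂̄H|`: tangential derivatives (along `L` and the angular directions) of all components. -/
def nTDH (H : Spt → Fin 4 → Fin 4 → ℝ) (p : Spt) : ℝ :=
  ∑ a : Fin 4, ∑ b : Fin 4,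
    (|mder H (Ldir p) p a b| + ∑ i : Fin 3, |mder H (angDir i p) p a b|)

/-- `|U^a L_b L_c ∂_a H^{bc}|` for the direction `v = U`. -/
def cLL (H : Spt → Fin 4 → Fin 4 → ℝ) (v : Spt) (p : Spt) : ℝ :=
  |∑ a : Fin 4, ∑ b : Fin 4, Llow p a * Llow p b * mder H v p a b|

/-- `|H|_{LL} = |H^{ab} L_a L_b|`. -/
def nHLL (H : Spt → Fin 4 → Fin 4 → ℝ) (p : Spt) : ℝ :=
  |∑ a : Fin 4, ∑ b : Fin 4, Llow p a * Llow p b * H p a b|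

/-- `|∂H|_{LL} = Σ_{U∈𝒩} |U^a L_b L_c ∂_a H^{bc}|`. -/
def nDHLL (H : Spt → Fin 4 → Fin 4 → ℝ) (p : Spt) : ℝ :=
  cLL H (Ldir p) p + cLL H (Lbardir p) p + ∑ i : Fin 3, cLL H (angDir i p) p

/-- `|∂̄H|_{LL} = Σ_{U∈𝒯} |U^a L_b L_c ∂_a H^{bc}|`. -/
def nTDHLL (H : Spt → Fin 4 → Fin 4 → ℝ) (p : Spt) : ℝ :=
  cLL H (Ldir p) p + ∑ i : Fin 3, cLL H (angDir i p) p

/-- `|∂φ|`: sum of coordinate derivatives of a scalar. -/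
def nDphi (φ : Spt → ℝ) (p : Spt) : ℝ := ∑ a : Fin 4, |pd a φ p|

/-- `|∂̄φ|`: tangential derivatives of a scalar. -/
def nTDphi (φ : Spt → ℝ) (p : Spt) : ℝ :=
  |fderiv ℝ φ p (Ldir p)| + ∑ i : Fin 3, |fderiv ℝ φ p (angDir i p)|

theorem aux_bound (M : Fin 4 → Fin 4 → ℝ) (x y : Fin 4 → ℝ) (X Y : ℝ)
    (hx : ∀ a, |x a| ≤ X) (hy : ∀ a, |y a| ≤ Y) :
    |∑ a, ∑ b, M a b * x a * y b| ≤ (∑ a, ∑ b, |M a b|) * (X * Y) := by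
  have hX : 0 ≤ X := le_trans (abs_nonneg _) (hx 0)
  refine (Finset.abs_sum_le_sum_abs _ _).trans ?_
  rw [Finset.sum_mul]
  refine Finset.sum_le_sum fun a _ => ?_
  refine (Finset.abs_sum_le_sum_abs _ _).trans ?_
  rw [Finset.sum_mul]
  refine Finset.sum_le_sum fun b _ => ?_
  rw [abs_mul, abs_mul, mul_assoc]
  exact mul_le_mul_of_nonneg_left
    (mul_le_mul (hx a) (hy b) (abs_nonneg _) hX) (abs_nonneg _)

/-- tangential part of a linear form -/
def tanP (p : Spt) (f : Spt →L[ℝ] ℝ) (a : Fin 4) : ℝ :=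
  Fin.cases (f (Ldir p)) (fun i => f (angDir i p)) a

theorem aux_dec (p : Spt) (f : Spt →L[ℝ] ℝ) (a : Fin 4) :
    f (dir a) = tanP p f a + Llow p a * f ((0:ℝ), omg p) := by
  refine Fin.cases ?_ (fun i => ?_) a
  · simp only [tanP, Llow, dir, Fin.cases_zero]
    have : ((1:ℝ), (0:E3)) = Ldir p - ((0:ℝ), omg p) := by
      simp [Ldir]
    rw [this, map_sub]; ring
  · simp only [tanP, Llow, dir, Fin.cases_succ]
    have : ((0:ℝ), (EuclideanSpace.single i (1:ℝ) : E3))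
        = angDir i p + omg p i • ((0:ℝ), omg p) := by
      simp [angDir]
    rw [this, map_add, map_smul, smul_eq_mul]

theorem aux_omg_norm (p : Spt) : ‖omg p‖ ≤ 1 := by
  unfold omg
  rw [norm_smul, norm_inv, norm_norm]
  exact inv_mul_le_one

theorem aux_omg (p : Spt) (i : Fin 3) : |omg p i| ≤ 1 := by
  have := (PiLp.norm_apply_le (omg p) i).trans (aux_omg_norm p)
  simpa using this

theorem aux_Llow (p : Spt) (a : Fin 4) : |Llow p a| ≤ 1 := by
  refine Fin.cases ?_ (fun i => ?_) a
  · simp [Llow]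
  · simpa [Llow] using aux_omg p i

theorem aux_q (p : Spt) (f : Spt →L[ℝ] ℝ) :
    |f ((0:ℝ), omg p)| ≤ ∑ a : Fin 4, |f (dir a)| := by
  have h : ((0:ℝ), omg p) = ∑ i : Fin 3, omg p i • dir i.succ := by
    have h1 : ∀ i : Fin 3, omg p i • dir i.succ
        = ((0:ℝ), omg p i • (EuclideanSpace.single i (1:ℝ) : E3)) := by
      intro i; simp [dir]
    simp only [h1]
    rw [Fin.sum_univ_three]
    simp only [Prod.mk_add_mk, add_zero]
    congr 1
    ext j
    fin_cases j <;> simp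
  rw [h, map_sum, Fin.sum_univ_succ (fun a : Fin 4 => |f (dir a)|)]
  refine (Finset.abs_sum_le_sum_abs _ _).trans ?_
  have : ∑ i : Fin 3, |f (omg p i • dir i.succ)| ≤ ∑ i : Fin 3, |f (dir i.succ)| := by
    refine Finset.sum_le_sum fun i _ => ?_
    rw [map_smul, smul_eq_mul, abs_mul]
    exact mul_le_of_le_one_left (abs_nonneg _) (aux_omg p i)
  linarith [abs_nonneg (f (dir 0))]

theorem aux_tanP (p : Spt) (f : Spt →L[ℝ] ℝ) (a : Fin 4) :
    |tanP p f a| ≤ |f (Ldir p)| + ∑ i : Fin 3, |f (angDir i p)| := by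
  refine Fin.cases ?_ (fun i => ?_) a
  · simp only [tanP, Fin.cases_zero]
    have : 0 ≤ ∑ i : Fin 3, |f (angDir i p)| := Finset.sum_nonneg fun i _ => abs_nonneg _
    linarith
  · simp only [tanP, Fin.cases_succ]
    have := Finset.single_le_sum (f := fun i : Fin 3 => |f (angDir i p)|)
      (fun i _ => abs_nonneg _) (Finset.mem_univ i)
    linarith [abs_nonneg (f (Ldir p))]

theorem aux_mder_q_sum (H : Spt → Fin 4 → Fin 4 → ℝ) (p : Spt) :
    ∑ a, ∑ b, |mder H ((0:ℝ), omg p) p a b| ≤ nDH H p := by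
  unfold nDH
  have e : ∑ c : Fin 4, ∑ a : Fin 4, ∑ b : Fin 4, |mder H (dir c) p a b|
      = ∑ a : Fin 4, ∑ b : Fin 4, ∑ c : Fin 4, |mder H (dir c) p a b| := by
    rw [Finset.sum_comm]
    exact Finset.sum_congr rfl fun a _ => Finset.sum_comm
  rw [e]
  exact Finset.sum_le_sum fun a _ => Finset.sum_le_sum fun b _ =>
    aux_q p (fderiv ℝ (fun q => H q a b) p)

theorem aux_mder_t_sum (H : Spt → Fin 4 → Fin 4 → ℝ) (p : Spt) :
    ∑ a, ∑ b, |mder H (dir 0) p a b| ≤ nDH H p := by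
  unfold nDH
  exact Finset.single_le_sum (f := fun c => ∑ a, ∑ b, |mder H (dir c) p a b|)
    (fun i _ => Finset.sum_nonneg fun _ _ => Finset.sum_nonneg fun _ _ => abs_nonneg _)
    (Finset.mem_univ 0)

theorem aux_mder_d_sum (H : Spt → Fin 4 → Fin 4 → ℝ) (p : Spt) :
    ∑ a, ∑ b, |mder H (dir a) p a b| ≤ nDH H p := by
  unfold nDH
  refine Finset.sum_le_sum fun c _ => ?_
  exact Finset.single_le_sum (f := fun a => ∑ b, |mder H (dir c) p a b|)
    (fun i _ => Finset.sum_nonneg fun _ _ => abs_nonneg _)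
    (Finset.mem_univ c)

theorem aux_T_sum (H : Spt → Fin 4 → Fin 4 → ℝ) (p : Spt) :
    ∑ a, ∑ b, |tanP p (fderiv ℝ (fun q => H q a b) p) a| ≤ nTDH H p := by
  unfold nTDH
  exact Finset.sum_le_sum fun a _ => Finset.sum_le_sum fun b _ => aux_tanP p _ a

theorem aux_LL (H : Spt → Fin 4 → Fin 4 → ℝ) (p : Spt) (v : Spt) (s : ℝ) (hs : |s| = 1)
    (hv : v = (2⁻¹:ℝ) • (Ldir p + s • Lbardir p)) :
    |∑ a : Fin 4, ∑ b : Fin 4, mder H v p a b * Llow p a * Llow p b| ≤ nDHLL H p := by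
  have e : ∑ a : Fin 4, ∑ b : Fin 4, mder H v p a b * Llow p a * Llow p b
      = 2⁻¹ * ((∑ a : Fin 4, ∑ b : Fin 4, Llow p a * Llow p b * mder H (Ldir p) p a b)
        + s * (∑ a : Fin 4, ∑ b : Fin 4, Llow p a * Llow p b * mder H (Lbardir p) p a b)) := by
    simp only [Finset.mul_sum, ← Finset.sum_add_distrib]
    refine Finset.sum_congr rfl fun a _ => Finset.sum_congr rfl fun b _ => ?_
    subst hv
    simp only [mder, map_smul, map_add, smul_eq_mul]
    ring
  have h3 : 0 ≤ ∑ i : Fin 3, cLL H (angDir i p) p := Finset.sum_nonneg fun i _ => abs_nonneg _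
  have h1 : 0 ≤ cLL H (Ldir p) p := abs_nonneg _
  have h2 : 0 ≤ cLL H (Lbardir p) p := abs_nonneg _
  rw [e, abs_mul]
  have := abs_add_le (∑ a : Fin 4, ∑ b : Fin 4, Llow p a * Llow p b * mder H (Ldir p) p a b)
     (s * (∑ a : Fin 4, ∑ b : Fin 4, Llow p a * Llow p b * mder H (Lbardir p) p a b))
  rw [abs_mul, hs, one_mul] at this
  change _ ≤ cLL H (Ldir p) p + cLL H (Lbardir p) p at this
  have h2' : |(2⁻¹:ℝ)| = 2⁻¹ := abs_of_pos (by norm_num)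
  rw [h2']
  unfold nDHLL
  linarith

theorem aux_first (H : Spt → Fin 4 → Fin 4 → ℝ) (φ : Spt → ℝ) (p : Spt) :
    |∑ a : Fin 4, ∑ b : Fin 4, mder H (dir 0) p a b * pd a φ p * pd b φ p|
      ≤ nDH H p * nTDphi φ p * nDphi φ p * 2 + nDHLL H p * (nDphi φ p)^2 := by
  set f := fderiv ℝ φ p with hf
  set q := f ((0:ℝ), omg p) with hq
  set M := mder H (dir 0) p with hM
  have hqb : |q| ≤ nDphi φ p := aux_q p f
  have hd : ∀ a, pd a φ p = tanP p f a + Llow p a * q := fun a => aux_dec p f a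
  have hT : ∀ a, |tanP p f a| ≤ nTDphi φ p := fun a => aux_tanP p f a
  have hD : ∀ a, |pd a φ p| ≤ nDphi φ p := fun a =>
    Finset.single_le_sum (f := fun a => |pd a φ p|) (fun i _ => abs_nonneg _) (Finset.mem_univ a)
  have hT0 : 0 ≤ nTDphi φ p := (abs_nonneg _).trans (hT 0)
  have hD0 : 0 ≤ nDphi φ p := (abs_nonneg _).trans (hD 0)
  have hMs : ∑ a, ∑ b, |M a b| ≤ nDH H p := aux_mder_t_sum H p
  have hN0 : 0 ≤ nDH H p :=
    (Finset.sum_nonneg fun _ _ => Finset.sum_nonneg fun _ _ => abs_nonneg _).trans hMs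
  have e : ∑ a : Fin 4, ∑ b : Fin 4, M a b * pd a φ p * pd b φ p
      = (∑ a, ∑ b, M a b * tanP p f a * pd b φ p)
        + q * (∑ a, ∑ b, M a b * Llow p a * tanP p f b)
        + q ^ 2 * (∑ a, ∑ b, M a b * Llow p a * Llow p b) := by
    simp only [Finset.mul_sum, ← Finset.sum_add_distrib]
    refine Finset.sum_congr rfl fun a _ => Finset.sum_congr rfl fun b _ => ?_
    rw [hd a, hd b]; ring
  have b1 := aux_bound M (tanP p f) (fun b => pd b φ p) _ _ hT hD
  have b2 := aux_bound M (Llow p) (tanP p f) _ _ (aux_Llow p) hT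
  have b3 : |∑ a, ∑ b, M a b * Llow p a * Llow p b| ≤ nDHLL H p := by
    refine aux_LL H p (dir 0) 1 (by simp) ?_
    simp only [dir, Fin.cases_zero, Ldir, Lbardir]
    ext <;> simp <;> norm_num
  have c1 := b1.trans (mul_le_mul_of_nonneg_right hMs (by positivity))
  have c2 := b2.trans (mul_le_mul_of_nonneg_right hMs (by positivity))
  rw [e]
  refine (abs_add_le _ _).trans ?_
  refine (add_le_add_left (abs_add_le _ _) _).trans ?_
  rw [abs_mul, abs_mul, abs_pow]
  have c3 := mul_le_mul hqb c2 (abs_nonneg _) hD0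
  have c4 := mul_le_mul (pow_le_pow_left₀ (abs_nonneg _) hqb 2) b3 (abs_nonneg _) (by positivity)
  nlinarith [c1, c3, c4]

theorem aux_second (H : Spt → Fin 4 → Fin 4 → ℝ) (φ : Spt → ℝ) (p : Spt) :
    |∑ a : Fin 4, ∑ b : Fin 4, mder H (dir a) p a b * pd b φ p|
      ≤ nTDH H p * nDphi φ p + nDH H p * nTDphi φ p + nDHLL H p * nDphi φ p := by
  set f := fderiv ℝ φ p with hf
  set q := f ((0:ℝ), omg p) with hq
  set M := mder H ((0:ℝ), omg p) p with hM
  have hqb : |q| ≤ nDphi φ p := aux_q p f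
  have hd : ∀ a, pd a φ p = tanP p f a + Llow p a * q := fun a => aux_dec p f a
  have hT : ∀ a, |tanP p f a| ≤ nTDphi φ p := fun a => aux_tanP p f a
  have hD : ∀ a, |pd a φ p| ≤ nDphi φ p := fun a =>
    Finset.single_le_sum (f := fun a => |pd a φ p|) (fun i _ => abs_nonneg _) (Finset.mem_univ a)
  have hT0 : 0 ≤ nTDphi φ p := (abs_nonneg _).trans (hT 0)
  have hD0 : 0 ≤ nDphi φ p := (abs_nonneg _).trans (hD 0)
  have hMs : ∑ a, ∑ b, |M a b| ≤ nDH H p := aux_mder_q_sum H p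
  set N : Fin 4 → Fin 4 → ℝ := fun a b => tanP p (fderiv ℝ (fun q => H q a b) p) a with hN
  have hm : ∀ a b, mder H (dir a) p a b = N a b + Llow p a * M a b := fun a b =>
    aux_dec p (fderiv ℝ (fun q => H q a b) p) a
  have e : ∑ a : Fin 4, ∑ b : Fin 4, mder H (dir a) p a b * pd b φ p
      = (∑ a, ∑ b, N a b * (fun _ => (1:ℝ)) a * pd b φ p)
        + (∑ a, ∑ b, M a b * Llow p a * tanP p f b)
        + q * (∑ a, ∑ b, M a b * Llow p a * Llow p b) := by
    simp only [Finset.mul_sum, ← Finset.sum_add_distrib]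
    refine Finset.sum_congr rfl fun a _ => Finset.sum_congr rfl fun b _ => ?_
    rw [hm a b, hd b]; ring
  have b1 := aux_bound N (fun _ => (1:ℝ)) (fun b => pd b φ p) 1 _ (fun _ => by simp) hD
  have b2 := aux_bound M (Llow p) (tanP p f) _ _ (aux_Llow p) hT
  have b3 : |∑ a, ∑ b, M a b * Llow p a * Llow p b| ≤ nDHLL H p := by
    refine aux_LL H p ((0:ℝ), omg p) (-1) (by simp) ?_
    simp only [Ldir, Lbardir]
    ext
    · simp
    · simp; ring
  have c1 := b1.trans (mul_le_mul_of_nonneg_right (aux_T_sum H p) (by positivity))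
  have c2 := b2.trans (mul_le_mul_of_nonneg_right hMs (by positivity))
  rw [e]
  refine (abs_add_le _ _).trans ?_
  refine (add_le_add_left (abs_add_le _ _) _).trans ?_
  rw [abs_mul]
  have c4 := mul_le_mul hqb b3 (abs_nonneg _) hD0
  linarith [c1, c2, c4]

theorem aux_first' (H : Spt → Fin 4 → Fin 4 → ℝ) (φ : Spt → ℝ) (p : Spt) :
    |∑ a : Fin 4, ∑ b : Fin 4, mder H (dir 0) p a b * pd a φ p * pd b φ p|
      ≤ nDH H p * (nDphi φ p)^2 := by
  have hD : ∀ a, |pd a φ p| ≤ nDphi φ p := fun a =>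
    Finset.single_le_sum (f := fun a => |pd a φ p|) (fun i _ => abs_nonneg _) (Finset.mem_univ a)
  have b1 := aux_bound (mder H (dir 0) p) (fun b => pd b φ p) (fun b => pd b φ p) _ _ hD hD
  rw [sq]
  exact b1.trans (mul_le_mul_of_nonneg_right (aux_mder_t_sum H p) (mul_self_nonneg _))

theorem aux_second' (H : Spt → Fin 4 → Fin 4 → ℝ) (φ : Spt → ℝ) (p : Spt) :
    |∑ a : Fin 4, ∑ b : Fin 4, mder H (dir a) p a b * pd b φ p|
      ≤ nDH H p * nDphi φ p := by
  have hD : ∀ a, |pd a φ p| ≤ nDphi φ p := fun a =>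
    Finset.single_le_sum (f := fun a => |pd a φ p|) (fun i _ => abs_nonneg _) (Finset.mem_univ a)
  have hD0 : 0 ≤ nDphi φ p := (abs_nonneg _).trans (hD 0)
  have b1 := aux_bound (fun a b => mder H (dir a) p a b) (fun _ => (1:ℝ)) (fun b => pd b φ p)
    1 _ (fun _ => by simp) hD
  simp only [mul_one, one_mul] at b1
  exact b1.trans (mul_le_mul_of_nonneg_right (aux_mder_d_sum H p) hD0)

/-- **Pointwise estimates from the metric assumptions** (estimates (est:derH) of
Proposition 8.2):  under the null-frame decay assumptions on `H`,
`|∂_t H^{ab} ∂_aφ ∂_bφ| ≤ Cε₀(⟨t+r⟩^{-1-2μ}|∂φ|² + ⟨t-r⟩^{-1/2-μ}⟨t+r⟩^{-1/2-μ}|∂̄φ||∂φ|)` and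
`|∂_a H^{ab} ∂_bφ| ≤ Cε₀(⟨t+r⟩^{-1-2μ}|∂φ| + ⟨t-r⟩^{-1/2-μ}⟨t+r⟩^{-1/2-μ}|∂̄φ|)`. -/
theorem metric_derivative_estimates (μ : ℝ) (hμ0 : 0 < μ) (hμ : μ < 1/2) :
    ∃ C : ℝ, 0 < C ∧
    ∀ ε₀ : ℝ, 0 < ε₀ →
    ∀ H : Spt → Fin 4 → Fin 4 → ℝ,
      (∀ a b : Fin 4, ContDiff ℝ (⊤:ℕ∞) (fun p => H p a b)) →
      (∀ (p : Spt) (a b : Fin 4), H p a b = H p b a) →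
      (∀ p : Spt,
        nH H p + jap (p.1 - ‖p.2‖) * nDH H p + jap (p.1 + ‖p.2‖) * nTDH H p
          ≤ ε₀ * jap (p.1 - ‖p.2‖) ^ ((1:ℝ)/2 - μ) * jap (p.1 + ‖p.2‖) ^ (-(1:ℝ)/2 - μ)) →
      (∀ p : Spt,
        nHLL H p + jap (p.1 - ‖p.2‖) * nDHLL H p + jap (p.1 + ‖p.2‖) * nTDHLL H p
          ≤ ε₀ * jap (p.1 - ‖p.2‖) * jap (p.1 + ‖p.2‖) ^ (-1 - 2*μ)) →
      ∀ φ : Spt → ℝ, ContDiff ℝ 1 φ → ∀ p : Spt,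
        |∑ a : Fin 4, ∑ b : Fin 4, mder H (dir 0) p a b * pd a φ p * pd b φ p|
            ≤ C * ε₀ * (jap (p.1 + ‖p.2‖) ^ (-1 - 2*μ) * (nDphi φ p)^2
              + jap (p.1 - ‖p.2‖) ^ (-(1:ℝ)/2 - μ) * jap (p.1 + ‖p.2‖) ^ (-(1:ℝ)/2 - μ)
                * nTDphi φ p * nDphi φ p) ∧
        |∑ a : Fin 4, ∑ b : Fin 4, mder H (dir a) p a b * pd b φ p|
            ≤ C * ε₀ * (jap (p.1 + ‖p.2‖) ^ (-1 - 2*μ) * nDphi φ p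
              + jap (p.1 - ‖p.2‖) ^ (-(1:ℝ)/2 - μ) * jap (p.1 + ‖p.2‖) ^ (-(1:ℝ)/2 - μ)
                * nTDphi φ p) := by
  refine ⟨2, by norm_num, ?_⟩
  intro ε hε H _ _ h1 h2 φ _ p
  have h1 := h1 p
  have h2 := h2 p
  have hum : 0 < jap (p.1 - ‖p.2‖) := by unfold jap; positivity
  have hup : 0 < jap (p.1 + ‖p.2‖) := by unfold jap; positivity
  generalize jap (p.1 - ‖p.2‖) = u at *
  generalize jap (p.1 + ‖p.2‖) = v at *
  have nH0 : 0 ≤ nH H p := Finset.sum_nonneg fun _ _ => Finset.sum_nonneg fun _ _ => abs_nonneg _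
  have nT0 : 0 ≤ nTDH H p := Finset.sum_nonneg fun _ _ => Finset.sum_nonneg fun _ _ =>
    add_nonneg (abs_nonneg _) (Finset.sum_nonneg fun _ _ => abs_nonneg _)
  have nD0 : 0 ≤ nDH H p := Finset.sum_nonneg fun _ _ => Finset.sum_nonneg fun _ _ =>
    Finset.sum_nonneg fun _ _ => abs_nonneg _
  have nL0 : 0 ≤ nHLL H p := abs_nonneg _
  have nTL0 : 0 ≤ nTDHLL H p :=
    add_nonneg (abs_nonneg _) (Finset.sum_nonneg fun _ _ => abs_nonneg _)
  have nDL0 : 0 ≤ nDHLL H p :=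
    add_nonneg (add_nonneg (abs_nonneg _) (abs_nonneg _)) (Finset.sum_nonneg fun _ _ => abs_nonneg _)
  have nP0 : 0 ≤ nDphi φ p := Finset.sum_nonneg fun _ _ => abs_nonneg _
  have nTP0 : 0 ≤ nTDphi φ p :=
    add_nonneg (abs_nonneg _) (Finset.sum_nonneg fun _ _ => abs_nonneg _)
  have hDH : nDH H p ≤ ε * (u ^ (-(1:ℝ)/2 - μ) * v ^ (-(1:ℝ)/2 - μ)) := by
    refine le_of_mul_le_mul_left ?_ hum
    have e : u ^ ((1:ℝ)/2 - μ) = u * u ^ (-(1:ℝ)/2 - μ) := by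
      rw [← Real.rpow_one_add' hum.le (by linarith)]; congr 1; ring
    rw [e] at h1
    have := mul_nonneg hup.le nT0
    linarith
  have hLL : nDHLL H p ≤ ε * v ^ (-1 - 2*μ) := by
    refine le_of_mul_le_mul_left ?_ hum
    have := mul_nonneg hup.le nTL0
    linarith
  have hJ : v ^ (-1 - 2*μ) = v ^ (-(1:ℝ)/2 - μ) * v ^ (-(1:ℝ)/2 - μ) := by
    rw [← Real.rpow_add hup]; congr 1; ring
  have hJ0 : 0 < v ^ (-1 - 2*μ) := Real.rpow_pos_of_pos hup _
  have hu0 : 0 < u ^ (-(1:ℝ)/2 - μ) := Real.rpow_pos_of_pos hum _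
  have hv0 : 0 < v ^ (-(1:ℝ)/2 - μ) := Real.rpow_pos_of_pos hup _
  rcases le_total v u with huv | huv
  · have hle : u ^ (-(1:ℝ)/2 - μ) ≤ v ^ (-(1:ℝ)/2 - μ) :=
      Real.rpow_le_rpow_of_nonpos hup huv (by linarith)
    have hDJ : nDH H p ≤ ε * v ^ (-1 - 2*μ) := by
      refine hDH.trans ?_
      rw [hJ]
      gcongr
    constructor
    · refine (aux_first' H φ p).trans ?_
      have a1 := mul_le_mul_of_nonneg_right hDJ (sq_nonneg (nDphi φ p))
      have a2 : 0 ≤ ε * (u ^ (-(1:ℝ)/2 - μ) * v ^ (-(1:ℝ)/2 - μ) * nTDphi φ p * nDphi φ p) := by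
        positivity
      have a3 : 0 ≤ ε * v ^ (-1 - 2*μ) * (nDphi φ p)^2 := by positivity
      linarith
    · refine (aux_second' H φ p).trans ?_
      have a1 := mul_le_mul_of_nonneg_right hDJ nP0
      have a2 : 0 ≤ ε * (u ^ (-(1:ℝ)/2 - μ) * v ^ (-(1:ℝ)/2 - μ) * nTDphi φ p) := by
        positivity
      have a3 : 0 ≤ ε * v ^ (-1 - 2*μ) * (nDphi φ p) := by positivity
      linarith
  · have hTD : nTDH H p ≤ ε * v ^ (-1 - 2*μ) := by
      refine le_of_mul_le_mul_left ?_ hup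
      have hle : u ^ ((1:ℝ)/2 - μ) ≤ v ^ ((1:ℝ)/2 - μ) :=
        Real.rpow_le_rpow hum.le huv (by linarith)
      have e : v ^ ((1:ℝ)/2 - μ) = v * v ^ (-(1:ℝ)/2 - μ) := by
        rw [← Real.rpow_one_add' hup.le (by linarith)]; congr 1; ring
      have a1 : ε * u ^ ((1:ℝ)/2 - μ) * v ^ (-(1:ℝ)/2 - μ)
          ≤ ε * v ^ ((1:ℝ)/2 - μ) * v ^ (-(1:ℝ)/2 - μ) := by gcongr
      rw [e] at a1
      rw [hJ]
      have := mul_nonneg hum.le nD0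
      linarith
    constructor
    · refine (aux_first H φ p).trans ?_
      have a1 := mul_le_mul_of_nonneg_right hLL (sq_nonneg (nDphi φ p))
      have a2 := mul_le_mul_of_nonneg_right hDH (mul_nonneg nTP0 nP0)
      have a3 : 0 ≤ ε * v ^ (-1 - 2*μ) * (nDphi φ p)^2 := by positivity
      linarith
    · refine (aux_second H φ p).trans ?_
      have a1 := mul_le_mul_of_nonneg_right hLL nP0
      have a2 := mul_le_mul_of_nonneg_right hDH nTP0
      have a3 := mul_le_mul_of_nonneg_right hTD nP0
      have a4 : 0 ≤ ε * (u ^ (-(1:ℝ)/2 - μ) * v ^ (-(1:ℝ)/2 - μ) * nTDphi φ p) := by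
        positivity
      linarith
end
end

section
/- For every γ>0 there is a constant C such that the following holds. Let v be a C² solution of the homogeneous wave equation □v=0 (□=−∂_t²+Δ) on [0,∞)×ℝ³ with initial data v(0,·)=v₀ and ∂_tv(0,·)=v₁. Then for all t≥0 and x∈ℝ³: (1+t+|x|) ⟨(|x|−t)₊⟩^{γ} |v(t,x)| ≤ C sup_{y∈ℝ³} ( (1+|y|)^{2+γ}(|v₁(y)|+|∇v₀(y)|) + (1+|y|)^{1+γ}|v₀(y)| ). -/
noncomputable section
open MeasureTheory

lemma swap_cont (F : ℝ → ℝ → ℝ) (hF : Continuous (Function.uncurry F)) (a b c d : ℝ) :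
    ∫ x in a..b, ∫ y in c..d, F x y = ∫ y in c..d, ∫ x in a..b, F x y := by
  apply intervalIntegral_intervalIntegral_swap
  have h : IntegrableOn (Function.uncurry F) (Set.uIcc a b ×ˢ Set.uIcc c d) (volume.prod volume) :=
    (hF.continuousOn).integrableOn_compact (isCompact_uIcc.prod isCompact_uIcc)
  exact h.mono_set (Set.prod_mono Set.uIoc_subset_uIcc Set.uIoc_subset_uIcc)

lemma cont_int {X : Type*} [TopologicalSpace X] (F : X → ℝ → ℝ)
    (hF : Continuous (Function.uncurry F)) (a b : ℝ) :
    Continuous fun x => ∫ y in a..b, F x y :=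
  intervalIntegral.continuous_parametric_intervalIntegral_of_continuous' hF a b

lemma int_zero' (f : ℝ → ℝ) (a b : ℝ) (h : ∀ s, f s = 0) : ∫ s in a..b, f s = 0 := by
  simp [h]

/-- abstract calculus: g_s + A_θ + B_φ = 0 implies the conservation law -/
lemma box_conserv (g A B g' A' B' : ℝ → ℝ → ℝ → ℝ) (t : ℝ) (ht : 0 ≤ t)
    (hg : ∀ s θ φ, HasDerivAt (fun s => g s θ φ) (g' s θ φ) s)
    (hA : ∀ s θ φ, HasDerivAt (fun θ => A s θ φ) (A' s θ φ) θ)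
    (hB : ∀ s θ φ, HasDerivAt (fun φ => B s θ φ) (B' s θ φ) φ)
    (cg : Continuous fun q : ℝ × ℝ × ℝ => g q.1 q.2.1 q.2.2)
    (cg' : Continuous fun q : ℝ × ℝ × ℝ => g' q.1 q.2.1 q.2.2)
    (cA' : Continuous fun q : ℝ × ℝ × ℝ => A' q.1 q.2.1 q.2.2)
    (cB' : Continuous fun q : ℝ × ℝ × ℝ => B' q.1 q.2.1 q.2.2)
    (hA0 : ∀ s φ, A s 0 φ = 0) (hA1 : ∀ s φ, A s Real.pi φ = 0)
    (hB1 : ∀ s θ, B s θ (2 * Real.pi) = B s θ 0)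
    (hsum : ∀ s ∈ Set.Icc 0 t, ∀ θ φ, g' s θ φ = - A' s θ φ - B' s θ φ) :
    ∫ θ in (0:ℝ)..Real.pi, ∫ φ in (0:ℝ)..(2 * Real.pi), g t θ φ
      = ∫ θ in (0:ℝ)..Real.pi, ∫ φ in (0:ℝ)..(2 * Real.pi), g 0 θ φ := by
  have e1 : ∀ θ φ, g t θ φ = g 0 θ φ
      - (∫ s in (0:ℝ)..t, A' s θ φ) - (∫ s in (0:ℝ)..t, B' s θ φ) := by
    intro θ φ
    have h1 := intervalIntegral.integral_eq_sub_of_hasDerivAt (a := 0) (b := t)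
      (fun s _ => hg s θ φ) (Continuous.intervalIntegrable
        (cg'.comp (by fun_prop : Continuous fun s : ℝ => (s, θ, φ))) _ _)
    have h2 : ∫ s in (0:ℝ)..t, g' s θ φ = ∫ s in (0:ℝ)..t, (- A' s θ φ - B' s θ φ) := by
      apply intervalIntegral.integral_congr
      intro s hs
      rw [Set.uIcc_of_le ht] at hs
      exact hsum s hs θ φ
    have h3 : ∫ s in (0:ℝ)..t, (- A' s θ φ - B' s θ φ) =
        - (∫ s in (0:ℝ)..t, A' s θ φ) - ∫ s in (0:ℝ)..t, B' s θ φ := by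
      rw [intervalIntegral.integral_sub, intervalIntegral.integral_neg]
      · exact Continuous.intervalIntegrable
          (cA'.comp (by fun_prop : Continuous fun s : ℝ => (s, θ, φ))).neg _ _
      · exact Continuous.intervalIntegrable
          (cB'.comp (by fun_prop : Continuous fun s : ℝ => (s, θ, φ))) _ _
    linarith
  have cIA : Continuous fun q : ℝ × ℝ => ∫ s in (0:ℝ)..t, A' s q.1 q.2 :=
    cont_int (fun (q : ℝ × ℝ) s => A' s q.1 q.2)
      (cA'.comp (by fun_prop : Continuous fun r : (ℝ × ℝ) × ℝ => (r.2, r.1.1, r.1.2))) _ _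
  have cIB : Continuous fun q : ℝ × ℝ => ∫ s in (0:ℝ)..t, B' s q.1 q.2 :=
    cont_int (fun (q : ℝ × ℝ) s => B' s q.1 q.2)
      (cB'.comp (by fun_prop : Continuous fun r : (ℝ × ℝ) × ℝ => (r.2, r.1.1, r.1.2))) _ _
  have cg0 : Continuous fun q : ℝ × ℝ => g 0 q.1 q.2 :=
    cg.comp (by fun_prop : Continuous fun r : ℝ × ℝ => ((0:ℝ), r.1, r.2))
  have cθ : ∀ θ : ℝ, Continuous fun φ : ℝ => (θ, φ) := fun θ => by fun_prop
  have zB : ∀ θ, ∫ φ in (0:ℝ)..(2 * Real.pi), ∫ s in (0:ℝ)..t, B' s θ φ = 0 := by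
    intro θ
    rw [swap_cont (fun φ s => B' s θ φ)
      (cB'.comp (by fun_prop : Continuous fun r : ℝ × ℝ => (r.2, θ, r.1)))]
    refine int_zero' _ _ _ fun s => ?_
    rw [intervalIntegral.integral_eq_sub_of_hasDerivAt (fun φ _ => hB s θ φ), hB1, sub_self]
    exact Continuous.intervalIntegrable
        (cB'.comp (by fun_prop : Continuous fun φ : ℝ => (s, θ, φ))) _ _
  have zA : ∫ θ in (0:ℝ)..Real.pi, ∫ φ in (0:ℝ)..(2 * Real.pi), ∫ s in (0:ℝ)..t, A' s θ φ = 0 := by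
    rw [swap_cont (fun θ φ => ∫ s in (0:ℝ)..t, A' s θ φ) cIA]
    refine int_zero' _ _ _ fun φ => ?_
    rw [swap_cont (fun θ s => A' s θ φ)
      (cA'.comp (by fun_prop : Continuous fun r : ℝ × ℝ => (r.2, r.1, φ)))]
    refine int_zero' _ _ _ fun s => ?_
    rw [intervalIntegral.integral_eq_sub_of_hasDerivAt (fun θ _ => hA s θ φ), hA0, hA1, sub_self]
    exact Continuous.intervalIntegrable
        (cA'.comp (by fun_prop : Continuous fun θ : ℝ => (s, θ, φ))) _ _
  have e2 : ∀ θ, ∫ φ in (0:ℝ)..(2 * Real.pi), g t θ φ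
      = (∫ φ in (0:ℝ)..(2 * Real.pi), g 0 θ φ)
        - ∫ φ in (0:ℝ)..(2 * Real.pi), ∫ s in (0:ℝ)..t, A' s θ φ := by
    intro θ
    simp_rw [e1]
    rw [intervalIntegral.integral_sub, intervalIntegral.integral_sub, zB, sub_zero]
    · exact (cg0.comp (cθ θ)).intervalIntegrable _ _
    · exact (cIA.comp (cθ θ)).intervalIntegrable _ _
    · exact ((cg0.comp (cθ θ)).sub (cIA.comp (cθ θ))).intervalIntegrable _ _
    · exact (cIB.comp (cθ θ)).intervalIntegrable _ _
  simp_rw [e2]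
  rw [intervalIntegral.integral_sub, zA, sub_zero]
  · exact (cont_int (fun θ φ => g 0 θ φ) cg0 _ _).intervalIntegrable _ _
  · exact (cont_int (fun θ φ => ∫ s in (0:ℝ)..t, A' s θ φ) cIA _ _).intervalIntegrable _ _

section
variable {F : Type*} [NormedAddCommGroup F] [NormedSpace ℝ F]

/-- unit vector in spherical coordinates -/
noncomputable def sph (e : Fin 3 → F) (θ φ : ℝ) : F :=
  (Real.sin θ * Real.cos φ) • e 0 + (Real.sin θ * Real.sin φ) • e 1 + Real.cos θ • e 2

noncomputable def sphθ (e : Fin 3 → F) (θ φ : ℝ) : F :=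
  (Real.cos θ * Real.cos φ) • e 0 + (Real.cos θ * Real.sin φ) • e 1 - Real.sin θ • e 2

noncomputable def sphφ (e : Fin 3 → F) (φ : ℝ) : F := (-Real.sin φ) • e 0 + Real.cos φ • e 1
noncomputable def sphφ' (e : Fin 3 → F) (φ : ℝ) : F := (-Real.cos φ) • e 0 + (-Real.sin φ) • e 1

lemma sph_dθ (e : Fin 3 → F) (θ φ : ℝ) :
    HasDerivAt (fun θ => sph e θ φ) (sphθ e θ φ) θ := by
  have h := ((((Real.hasDerivAt_sin θ).mul_const (Real.cos φ)).smul_const (e 0)).add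
    (((Real.hasDerivAt_sin θ).mul_const (Real.sin φ)).smul_const (e 1))).add
    ((Real.hasDerivAt_cos θ).smul_const (e 2))
  refine h.congr_deriv ?_
  simp only [sphθ]; module

lemma sphθ_dθ (e : Fin 3 → F) (θ φ : ℝ) :
    HasDerivAt (fun θ => sphθ e θ φ) (-sph e θ φ) θ := by
  have h := ((((Real.hasDerivAt_cos θ).mul_const (Real.cos φ)).smul_const (e 0)).add
    (((Real.hasDerivAt_cos θ).mul_const (Real.sin φ)).smul_const (e 1))).sub
    ((Real.hasDerivAt_sin θ).smul_const (e 2))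
  refine h.congr_deriv ?_
  simp only [sph]; module

lemma sph_dφ (e : Fin 3 → F) (θ φ : ℝ) :
    HasDerivAt (fun φ => sph e θ φ) (Real.sin θ • sphφ e φ) φ := by
  have h := ((((Real.hasDerivAt_cos φ).const_mul (Real.sin θ)).smul_const (e 0)).add
    (((Real.hasDerivAt_sin φ).const_mul (Real.sin θ)).smul_const (e 1))).add_const
    (Real.cos θ • e 2)
  refine h.congr_deriv ?_
  simp only [sphφ]; module

lemma sphφ_dφ (e : Fin 3 → F) (φ : ℝ) :
    HasDerivAt (fun φ => sphφ e φ) (sphφ' e φ) φ := by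
  exact (((Real.hasDerivAt_sin φ).neg).smul_const (e 0)).add
    ((Real.hasDerivAt_cos φ).smul_const (e 1))

lemma path_deriv (V : F → F →L[ℝ] ℝ) (H : F →L[ℝ] F →L[ℝ] ℝ) (c w : ℝ → F) (c' w' : F) (s : ℝ)
    (hV : HasFDerivAt V H (c s)) (hc : HasDerivAt c c' s) (hw : HasDerivAt w w' s) :
    HasDerivAt (fun s => V (c s) (w s)) (H c' (w s) + V (c s) w') s := by
  have h1 : HasDerivAt (fun s => V (c s)) (H c') s := hV.comp_hasDerivAt s hc
  exact h1.clm_apply hw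

set_option maxHeartbeats 1000000 in
lemma kirchhoff_abs (v : F → ℝ) (hv : ContDiff ℝ 2 v) (T X : F) (e : Fin 3 → F) (t : ℝ)
    (ht : 0 ≤ t)
    (hbox : ∀ s ∈ Set.Icc 0 t, ∀ θ φ,
      fderiv ℝ (fderiv ℝ v) ((t - s) • T + X + s • sph e θ φ) T T =
        ∑ i, fderiv ℝ (fderiv ℝ v) ((t - s) • T + X + s • sph e θ φ) (e i) (e i)) :
    ∫ θ in (0:ℝ)..Real.pi, ∫ φ in (0:ℝ)..(2 * Real.pi),
      Real.sin θ * (v (X + t • sph e θ φ) +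
        t * fderiv ℝ v (X + t • sph e θ φ) (T + sph e θ φ)) = 4 * Real.pi * v (t • T + X) := by
  set V := fderiv ℝ v with hV
  set H := fderiv ℝ V with hH
  have cV1 : ContDiff ℝ 1 V := hv.fderiv_right (by norm_num)
  have cV : Continuous V := cV1.continuous
  have cH : Continuous H := cV1.continuous_fderiv (by norm_num)
  have cv : Continuous v := hv.continuous
  have dv : ∀ q, HasFDerivAt v (V q) q := fun q => (hv.differentiable (by norm_num) q).hasFDerivAt
  have dV : ∀ q, HasFDerivAt V (H q) q := fun q => (cV1.differentiable (by norm_num) q).hasFDerivAt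
  have sym : ∀ q a b, H q a b = H q b a := by
    intro q a b
    have := (hv.contDiffAt (x := q)).isSymmSndFDerivAt (by simp)
    exact this a b
  let p : ℝ → ℝ → ℝ → F := fun s θ φ => (t - s) • T + X + s • sph e θ φ
  have cs : Continuous fun q : ℝ × ℝ × ℝ => sph e q.2.1 q.2.2 := by
    unfold sph; fun_prop
  have csθ : Continuous fun q : ℝ × ℝ × ℝ => sphθ e q.2.1 q.2.2 := by
    unfold sphθ; fun_prop
  have csφ : Continuous fun q : ℝ × ℝ × ℝ => sphφ e q.2.2 := by
    unfold sphφ; fun_prop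
  have csφ' : Continuous fun q : ℝ × ℝ × ℝ => sphφ' e q.2.2 := by
    unfold sphφ'; fun_prop
  have cp : Continuous fun q : ℝ × ℝ × ℝ => p q.1 q.2.1 q.2.2 := by
    simp only [p]; fun_prop
  have ps : ∀ s θ φ, HasDerivAt (fun s => p s θ φ) (-T + sph e θ φ) s := by
    intro s θ φ
    have h := ((((hasDerivAt_id s).const_sub t).smul_const T).add_const X).add
      ((hasDerivAt_id s).smul_const (sph e θ φ))
    exact h.congr_deriv (by module)
  have pθ : ∀ s θ φ, HasDerivAt (fun θ => p s θ φ) (s • sphθ e θ φ) θ := fun s θ φ =>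
    ((sph_dθ e θ φ).const_smul s).const_add _
  have pφ : ∀ s θ φ, HasDerivAt (fun φ => p s θ φ) (s • Real.sin θ • sphφ e φ) φ := fun s θ φ =>
    ((sph_dφ e θ φ).const_smul s).const_add _
  have key := box_conserv
    (fun s θ φ => Real.sin θ * (v (p s θ φ) + s * V (p s θ φ) (T + sph e θ φ)))
    (fun s θ φ => Real.sin θ * V (p s θ φ) (sphθ e θ φ))
    (fun s θ φ => V (p s θ φ) (sphφ e φ))
    (fun s θ φ => Real.sin θ * (V (p s θ φ) (-T + sph e θ φ) + (V (p s θ φ) (T + sph e θ φ)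
        + s * H (p s θ φ) (-T + sph e θ φ) (T + sph e θ φ))))
    (fun s θ φ => Real.cos θ * V (p s θ φ) (sphθ e θ φ) +
       Real.sin θ * (H (p s θ φ) (s • sphθ e θ φ) (sphθ e θ φ) + V (p s θ φ) (-sph e θ φ)))
    (fun s θ φ => H (p s θ φ) (s • Real.sin θ • sphφ e φ) (sphφ e φ) + V (p s θ φ) (sphφ' e φ))
    t ht ?_ ?_ ?_ ?_ ?_ ?_ ?_ ?_ ?_ ?_ ?_
  · simp only [p, sub_self, zero_smul, zero_add, sub_zero, add_zero, zero_mul] at key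
    rw [key]
    simp only [intervalIntegral.integral_const, intervalIntegral.integral_mul_const,
      intervalIntegral.integral_const_mul, integral_sin, smul_eq_mul, Real.cos_pi, Real.cos_zero]
    ring
  · intro s θ φ
    have h1 := (dv (p s θ φ)).comp_hasDerivAt s (ps s θ φ)
    have h2 := path_deriv V (H (p s θ φ)) (fun s => p s θ φ) (fun _ => T + sph e θ φ) _ _ s
      (dV (p s θ φ)) (ps s θ φ) (hasDerivAt_const s (T + sph e θ φ))
    have h3 := ((h1.add ((hasDerivAt_id s).mul h2)).const_mul (Real.sin θ))
    refine h3.congr_deriv ?_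
    simp
  · intro s θ φ
    have h2 := path_deriv V (H (p s θ φ)) (fun θ => p s θ φ) (fun θ => sphθ e θ φ) _ _ θ
      (dV (p s θ φ)) (pθ s θ φ) (sphθ_dθ e θ φ)
    exact (Real.hasDerivAt_sin θ).mul h2
  · intro s θ φ
    exact path_deriv V (H (p s θ φ)) (fun φ => p s θ φ) (fun φ => sphφ e φ) _ _ φ
      (dV (p s θ φ)) (pφ s θ φ) (sphφ_dφ e φ)
  · fun_prop
  · fun_prop
  · fun_prop
  · fun_prop
  · intro s φ; simp
  · intro s φ; simp
  · intro s θ; simp [p, sph, sphφ]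
  · intro s hs θ φ
    have hb := hbox s hs θ φ
    change H (p s θ φ) T T = ∑ i, H (p s θ φ) (e i) (e i) at hb
    generalize p s θ φ = P at *
    rw [Fin.sum_univ_three] at hb
    have s1 := sym P T (e 0)
    have s2 := sym P T (e 1)
    have s3 := sym P T (e 2)
    have s4 := sym P (e 0) (e 1)
    have s5 := sym P (e 0) (e 2)
    have s6 := sym P (e 1) (e 2)
    have c1 := Real.sin_sq_add_cos_sq θ
    have c2 := Real.sin_sq_add_cos_sq φ
    simp only [sph, sphθ, sphφ, sphφ', map_add, map_sub, map_neg, map_smul,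
      _root_.add_apply, _root_.sub_apply, _root_.neg_apply,
      _root_.smul_apply, smul_eq_mul, hb, s1, s2, s3, s4, s5, s6]
    generalize Real.sin θ = a at *
    generalize Real.cos θ = b at *
    generalize Real.sin φ = c at *
    generalize Real.cos φ = d at *
    linear_combination (d * V P (e 0) + c * V P (e 1) + s * a * (d ^ 2 * H P (e 0) (e 0)
      + 2 * c * d * H P (e 1) (e 0) + c ^ 2 * H P (e 1) (e 1) + H P (e 2) (e 2))) * c1
      + s * a * (H P (e 0) (e 0) + H P (e 1) (e 1)) * c2
end

noncomputable def rho (r t θ : ℝ) : ℝ := Real.sqrt (r ^ 2 + t ^ 2 + 2 * r * t * Real.cos θ)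

lemma rho_arg (r t θ : ℝ) (hr : 0 ≤ r) (ht : 0 ≤ t) :
    (r - t) ^ 2 ≤ r ^ 2 + t ^ 2 + 2 * r * t * Real.cos θ := by
  nlinarith [Real.neg_one_le_cos θ, mul_nonneg hr ht]

lemma rho_ge (r t θ : ℝ) (hr : 0 ≤ r) (ht : 0 ≤ t) : |r - t| ≤ rho r t θ := by
  apply Real.abs_le_sqrt
  exact rho_arg r t θ hr ht

lemma rho_cont (r t : ℝ) : Continuous (rho r t) := by
  unfold rho; fun_prop

lemma rho_nn (r t θ : ℝ) : 0 ≤ rho r t θ := Real.sqrt_nonneg _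

lemma rho_pow_cont (r t a : ℝ) : Continuous fun θ => (1 + rho r t θ) ^ a :=
  ((continuous_const.add (rho_cont r t))).rpow_const
    (fun θ => Or.inl (ne_of_gt (by have := rho_nn r t θ; show 0 < 1 + rho r t θ; linarith)))

lemma sqrt_le_one_add (r t θ : ℝ) (hr : 0 ≤ r) (ht : 0 ≤ t) :
    (1 + (r ^ 2 + t ^ 2 + 2 * r * t * Real.cos θ)) ≤ (1 + rho r t θ) ^ 2 := by
  have h : rho r t θ ^ 2 = r ^ 2 + t ^ 2 + 2 * r * t * Real.cos θ :=
    Real.sq_sqrt ((sq_nonneg _).trans (rho_arg r t θ hr ht))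
  nlinarith [rho_nn r t θ]

/-- FTC for powers. -/
lemma ftc_pow (r t a : ℝ) (hr : 0 < r) (ht : 0 < t) (ha : a ≠ 0) :
    ∫ θ in (0:ℝ)..Real.pi, Real.sin θ * (1 + (r ^ 2 + t ^ 2 + 2 * r * t * Real.cos θ)) ^ (a - 1)
      = ((1 + (r + t) ^ 2) ^ a - (1 + (r - t) ^ 2) ^ a) / (2 * r * t * a) := by
  have pos : ∀ θ, 0 < 1 + (r ^ 2 + t ^ 2 + 2 * r * t * Real.cos θ) := fun θ => by
    nlinarith [rho_arg r t θ hr.le ht.le, sq_nonneg (r - t)]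
  have hd : ∀ θ, HasDerivAt
      (fun θ => - (1 + (r ^ 2 + t ^ 2 + 2 * r * t * Real.cos θ)) ^ a / (2 * r * t * a))
      (Real.sin θ * (1 + (r ^ 2 + t ^ 2 + 2 * r * t * Real.cos θ)) ^ (a - 1)) θ := by
    intro θ
    have h1 : HasDerivAt (fun θ => 1 + (r ^ 2 + t ^ 2 + 2 * r * t * Real.cos θ))
        (2 * r * t * (- Real.sin θ)) θ :=
      (((Real.hasDerivAt_cos θ).const_mul (2 * r * t)).const_add _).const_add _
    have h2 := ((h1.rpow_const (p := a) (Or.inl (pos θ).ne')).neg).div_const (2 * r * t * a)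
    refine h2.congr_deriv ?_
    field_simp
  rw [intervalIntegral.integral_eq_sub_of_hasDerivAt (fun θ _ => hd θ)]
  · rw [Real.cos_pi, Real.cos_zero]
    rw [show r ^ 2 + t ^ 2 + 2 * r * t * -1 = (r - t) ^ 2 by ring,
      show r ^ 2 + t ^ 2 + 2 * r * t * 1 = (r + t) ^ 2 by ring]
    ring
  · apply Continuous.intervalIntegrable
    apply Real.continuous_sin.mul
    exact Continuous.rpow_const (by fun_prop) (fun θ => Or.inl (pos θ).ne')

lemma J_int (γ r t : ℝ) : IntervalIntegrable (fun θ => Real.sin θ *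
    ((1 + rho r t θ) ^ (-(1 + γ)) + t * (1 + rho r t θ) ^ (-(2 + γ)))) volume 0 Real.pi := by
  apply Continuous.intervalIntegrable
  exact Real.continuous_sin.mul ((rho_pow_cont r t _).add
    (continuous_const.mul (rho_pow_cont r t _)))

lemma J_easy (γ r t : ℝ) (hγ : 0 < γ) (hr : 0 ≤ r) (ht : 0 ≤ t)
    (h : 1 + t + r ≤ 3 * (1 + |r - t|)) :
    (1 + t + r) * (1 + max (r - t) 0) ^ γ * ∫ θ in (0:ℝ)..Real.pi, Real.sin θ *
    ((1 + rho r t θ) ^ (-(1 + γ)) + t * (1 + rho r t θ) ^ (-(2 + γ))) ≤ 24 := by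
  set m := |r - t| with hm
  have hm0 : 0 ≤ m := abs_nonneg _
  have hJ : ∫ θ in (0:ℝ)..Real.pi, Real.sin θ *
      ((1 + rho r t θ) ^ (-(1 + γ)) + t * (1 + rho r t θ) ^ (-(2 + γ)))
      ≤ ∫ θ in (0:ℝ)..Real.pi, Real.sin θ * (4 * (1 + m) ^ (-(1 + γ))) := by
    apply intervalIntegral.integral_mono_on Real.pi_pos.le (J_int γ r t)
    · exact Continuous.intervalIntegrable (by fun_prop) _ _
    intro θ hθ
    apply mul_le_mul_of_nonneg_left _ (Real.sin_nonneg_of_mem_Icc hθ)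
    have hρ := rho_ge r t θ hr ht
    have h1 : (1 + rho r t θ) ^ (-(1 + γ)) ≤ (1 + m) ^ (-(1 + γ)) :=
      Real.rpow_le_rpow_of_nonpos (by positivity) (by linarith) (by linarith)
    have h2 : (1 + rho r t θ) ^ (-(2 + γ)) ≤ (1 + m) ^ (-(2 + γ)) :=
      Real.rpow_le_rpow_of_nonpos (by positivity) (by linarith) (by linarith)
    have h3 : (1 + m) * (1 + m) ^ (-(2 + γ)) = (1 + m) ^ (-(1 + γ)) := by
      rw [← Real.rpow_one_add' (by positivity) (by linarith)]; congr 1; ring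
    have h4 : t * (1 + rho r t θ) ^ (-(2 + γ)) ≤ 3 * (1 + m) * (1 + m) ^ (-(2 + γ)) := by
      apply mul_le_mul (by linarith) h2 _ (by positivity)
      have := rho_nn r t θ
      positivity
    nlinarith
  rw [intervalIntegral.integral_mul_const, integral_sin, Real.cos_zero, Real.cos_pi] at hJ
  have hw : (1 + max (r - t) 0) ^ γ ≤ (1 + m) ^ γ := by
    apply Real.rpow_le_rpow (by positivity) _ hγ.le
    have := max_le (le_abs_self (r - t)) (abs_nonneg (r - t))
    linarith
  have h5 : (1 + m) * (1 + m) ^ γ * (1 + m) ^ (-(1 + γ)) = 1 := by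
    rw [← Real.rpow_one_add' (by positivity) (by linarith), ← Real.rpow_add (by positivity)]
    simp
  calc _ ≤ (3 * (1 + m)) * (1 + m) ^ γ * ((1 - -1) * (4 * (1 + m) ^ (-(1 + γ)))) := by
        apply (mul_le_mul_of_nonneg_left hJ (by positivity)).trans
        apply mul_le_mul_of_nonneg_right _ (by positivity)
        apply mul_le_mul h hw (by positivity) (by positivity)
    _ = 24 * ((1 + m) * (1 + m) ^ γ * (1 + m) ^ (-(1 + γ))) := by ring
    _ ≤ 24 := by rw [h5]; norm_num

lemma J_hard (γ r t : ℝ) (hγ : 0 < γ) (hr : 0 ≤ r) (ht : 0 ≤ t)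
    (h : 3 * (1 + |r - t|) ≤ 1 + t + r) :
    (1 + t + r) * (1 + max (r - t) 0) ^ γ * ∫ θ in (0:ℝ)..Real.pi, Real.sin θ *
    ((1 + rho r t θ) ^ (-(1 + γ)) + t * (1 + rho r t θ) ^ (-(2 + γ))) ≤
      9 + 3 * 2 ^ (γ / 2) / γ := by
  set m := |r - t| with hm
  have hm0 : 0 ≤ m := abs_nonneg _
  have ha1 : r - t ≤ m := le_abs_self _
  have ha2 : t - r ≤ m := by rw [hm, abs_sub_comm]; exact le_abs_self _
  have r0 : 0 < r := by linarith
  have t0 : 0 < t := by linarith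
  have k1 : 1 + t + r ≤ 3 * r := by linarith
  have k2 : 1 + t + r ≤ 3 * t := by linarith
  have hp1 : 0 < (1 + m) ^ (-γ) := by positivity
  have msq : m ^ 2 = (r - t) ^ 2 := sq_abs _
  let u : ℝ → ℝ := fun θ => 1 + (r ^ 2 + t ^ 2 + 2 * r * t * Real.cos θ)
  have pos : ∀ θ, 0 < u θ := fun θ => by
    show 0 < 1 + (r ^ 2 + t ^ 2 + 2 * r * t * Real.cos θ)
    nlinarith [rho_arg r t θ hr ht, sq_nonneg (r - t)]
  have cu : ∀ a : ℝ, Continuous fun θ => u θ ^ a := fun a =>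
    Continuous.rpow_const (by simp only [u]; fun_prop) (fun θ => Or.inl (pos θ).ne')
  have hu : ∀ a θ : ℝ, 0 ≤ a → (1 + rho r t θ) ^ (-(2 * a)) ≤ u θ ^ (-a) := by
    intro a θ ha
    have hρ := rho_nn r t θ
    rw [show -(2 * a) = 2 * (-a) by ring, Real.rpow_mul (by positivity), Real.rpow_two]
    exact Real.rpow_le_rpow_of_nonpos (pos θ) (sqrt_le_one_add r t θ hr ht) (by linarith)
  have i1 := ftc_pow r t (1 / 2) r0 t0 (by norm_num)
  have i2 := ftc_pow r t (-(γ / 2)) r0 t0 (by linarith)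
  have hJ : ∫ θ in (0:ℝ)..Real.pi, Real.sin θ *
      ((1 + rho r t θ) ^ (-(1 + γ)) + t * (1 + rho r t θ) ^ (-(2 + γ)))
      ≤ ∫ θ in (0:ℝ)..Real.pi, ((1 + m) ^ (-γ) * (Real.sin θ * u θ ^ ((1 / 2 : ℝ) - 1)) +
          t * (Real.sin θ * u θ ^ (-(γ / 2) - 1))) := by
    apply intervalIntegral.integral_mono_on Real.pi_pos.le (J_int γ r t)
    · apply Continuous.intervalIntegrable
      have := cu ((1 / 2 : ℝ) - 1)
      have := cu (-(γ / 2) - 1)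
      fun_prop
    intro θ hθ
    have hs := Real.sin_nonneg_of_mem_Icc hθ
    have hρ := rho_ge r t θ hr ht
    have h1 : (1 + rho r t θ) ^ (-(1 + γ)) ≤ (1 + m) ^ (-γ) * u θ ^ ((1 / 2 : ℝ) - 1) := by
      rw [show -(1 + γ) = -γ + -(2 * (1 / 2)) by ring, Real.rpow_add (by linarith)]
      apply mul_le_mul
      · exact Real.rpow_le_rpow_of_nonpos (by positivity) (by linarith) (by linarith)
      · have := hu (1 / 2) θ (by norm_num)
        rwa [show -(1 / 2 : ℝ) = 1 / 2 - 1 by norm_num] at this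
      · have := rho_nn r t θ; positivity
      · positivity
    have h2 : (1 + rho r t θ) ^ (-(2 + γ)) ≤ u θ ^ (-(γ / 2) - 1) := by
      have := hu (1 + γ / 2) θ (by linarith)
      rwa [show -(1 + γ / 2) = -(γ / 2) - 1 by ring,
        show -(2 * (1 + γ / 2)) = -(2 + γ) by ring] at this
    calc _ ≤ Real.sin θ * ((1 + m) ^ (-γ) * u θ ^ ((1 / 2 : ℝ) - 1) +
            t * u θ ^ (-(γ / 2) - 1)) := by gcongr
      _ = _ := by ring
  have hI : ∫ θ in (0:ℝ)..Real.pi, ((1 + m) ^ (-γ) * (Real.sin θ * u θ ^ ((1 / 2 : ℝ) - 1)) +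
          t * (Real.sin θ * u θ ^ (-(γ / 2) - 1))) =
      (1 + m) ^ (-γ) * (((1 + (r + t) ^ 2) ^ (1 / 2 : ℝ) - (1 + (r - t) ^ 2) ^ (1 / 2 : ℝ))
         / (2 * r * t * (1 / 2))) +
      t * (((1 + (r + t) ^ 2) ^ (-(γ / 2)) - (1 + (r - t) ^ 2) ^ (-(γ / 2)))
         / (2 * r * t * (-(γ / 2)))) := by
    rw [intervalIntegral.integral_add, intervalIntegral.integral_const_mul,
      intervalIntegral.integral_const_mul, i1, i2]
    · exact Continuous.intervalIntegrable
        (continuous_const.mul (Real.continuous_sin.mul (cu _))) _ _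
    · exact Continuous.intervalIntegrable
        (continuous_const.mul (Real.continuous_sin.mul (cu _))) _ _
  rw [hI] at hJ
  have b1 : ((1 + (r + t) ^ 2) ^ (1 / 2 : ℝ) - (1 + (r - t) ^ 2) ^ (1 / 2 : ℝ))
         / (2 * r * t * (1 / 2)) ≤ 3 / r := by
    have e1 : (1 + (r + t) ^ 2) ^ (1 / 2 : ℝ) ≤ 1 + t + r := by
      rw [← Real.sqrt_eq_rpow]
      apply Real.sqrt_le_iff.2 ⟨by positivity, by nlinarith⟩
    have e2 : 0 ≤ (1 + (r - t) ^ 2) ^ (1 / 2 : ℝ) := by positivity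
    rw [div_le_div_iff₀ (by positivity) r0]
    nlinarith
  have b2 : t * (((1 + (r + t) ^ 2) ^ (-(γ / 2)) - (1 + (r - t) ^ 2) ^ (-(γ / 2)))
         / (2 * r * t * (-(γ / 2)))) ≤ (2 ^ (γ / 2) / γ * (1 + m) ^ (-γ)) / r := by
    have e1 : 0 ≤ (1 + (r + t) ^ 2) ^ (-(γ / 2)) := by positivity
    have e2 : (1 + (r - t) ^ 2) ^ (-(γ / 2)) ≤ 2 ^ (γ / 2) * (1 + m) ^ (-γ) := by
      have : (1 + (r - t) ^ 2) ^ (-(γ / 2)) ≤ ((1 + m) ^ 2 / 2) ^ (-(γ / 2)) := by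
        apply Real.rpow_le_rpow_of_nonpos (by positivity) (by nlinarith [sq_nonneg (1 - m)])
          (by linarith)
      refine this.trans (le_of_eq ?_)
      rw [Real.div_rpow (by positivity) (by norm_num), ← Real.rpow_natCast, ← Real.rpow_mul
        (by positivity), Real.rpow_neg (by norm_num : (0:ℝ) ≤ 2), div_inv_eq_mul, mul_comm]
      congr 2
      push_cast; ring
    have e3 : t * (((1 + (r + t) ^ 2) ^ (-(γ / 2)) - (1 + (r - t) ^ 2) ^ (-(γ / 2)))
         / (2 * r * t * (-(γ / 2)))) = ((1 + (r - t) ^ 2) ^ (-(γ / 2)) -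
          (1 + (r + t) ^ 2) ^ (-(γ / 2))) / γ / r := by
      field_simp
      ring
    rw [e3, div_mul_eq_mul_div]
    gcongr
    linarith
  have hw : (1 + max (r - t) 0) ^ γ ≤ (1 + m) ^ γ := by
    apply Real.rpow_le_rpow (by positivity) _ hγ.le
    have := max_le ha1 hm0
    linarith
  have h5 : (1 + m) ^ γ * (1 + m) ^ (-γ) = 1 := by
    rw [← Real.rpow_add (by positivity)]
    simp
  have hJ2 : ∫ θ in (0:ℝ)..Real.pi, Real.sin θ *
      ((1 + rho r t θ) ^ (-(1 + γ)) + t * (1 + rho r t θ) ^ (-(2 + γ)))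
      ≤ (1 + m) ^ (-γ) * ((3 + 2 ^ (γ / 2) / γ) / r) := by
    calc _ ≤ _ := hJ
      _ ≤ (1 + m) ^ (-γ) * (3 / r) + (2 ^ (γ / 2) / γ * (1 + m) ^ (-γ)) / r := by gcongr
      _ = _ := by ring
  calc _ ≤ (3 * r) * (1 + m) ^ γ * ((1 + m) ^ (-γ) * ((3 + 2 ^ (γ / 2) / γ) / r)) := by
        apply (mul_le_mul_of_nonneg_left hJ2 (by positivity)).trans
        apply mul_le_mul_of_nonneg_right _ (by positivity)
        apply mul_le_mul k1 hw (by positivity) (by positivity)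
    _ = ((1 + m) ^ γ * (1 + m) ^ (-γ)) * (3 * (3 + 2 ^ (γ / 2) / γ)) := by field_simp
    _ ≤ _ := by rw [h5]; apply le_of_eq; ring

lemma J_bound (γ r t : ℝ) (hγ : 0 < γ) (hr : 0 ≤ r) (ht : 0 ≤ t) :
    (1 + t + r) * (1 + max (r - t) 0) ^ γ * ∫ θ in (0:ℝ)..Real.pi, Real.sin θ *
    ((1 + rho r t θ) ^ (-(1 + γ)) + t * (1 + rho r t θ) ^ (-(2 + γ))) ≤
      24 + (9 + 3 * 2 ^ (γ / 2) / γ) := by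
  have : 0 < 3 * 2 ^ (γ / 2) / γ := by positivity
  rcases le_total (1 + t + r) (3 * (1 + |r - t|)) with h | h
  · exact (J_easy γ r t hγ hr ht h).trans (by linarith)
  · exact (J_hard γ r t hγ hr ht h).trans (by linarith)
lemma trace_inv {E : Type*} [NormedAddCommGroup E] [InnerProductSpace ℝ E]
    (H : E →L[ℝ] E →L[ℝ] ℝ) (b c : OrthonormalBasis (Fin 3) ℝ E) :
    ∑ i, H (b i) (b i) = ∑ i, H (c i) (c i) := by
  have h1 : ∀ i, H (b i) (b i) = ∑ k, inner ℝ (c k) (b i) * H (b i) (c k) := by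
    intro i
    have h : ∀ f : E →L[ℝ] ℝ, f (b i) = ∑ k, inner ℝ (c k) (b i) * f (c k) := by
      intro f
      conv_lhs => rw [← c.sum_repr' (b i)]
      rw [map_sum]
      simp_rw [map_smul, smul_eq_mul]
    exact h _
  have h2 : ∀ k, H (c k) (c k) = ∑ i, inner ℝ (c k) (b i) * H (b i) (c k) := by
    intro k
    have h : H (c k) = ∑ i, inner ℝ (c k) (b i) • H (b i) := by
      conv_lhs => rw [← b.sum_repr' (c k)]
      rw [map_sum]
      simp_rw [map_smul, real_inner_comm]
    rw [h]
    simp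
  simp_rw [h1, h2]
  exact Finset.sum_comm

lemma norm_comb {E : Type*} [NormedAddCommGroup E] [InnerProductSpace ℝ E]
    (b : OrthonormalBasis (Fin 3) ℝ E) (x y z : ℝ) :
    ‖x • b 0 + y • b 1 + z • b 2‖ = Real.sqrt (x ^ 2 + y ^ 2 + z ^ 2) := by
  rw [eq_comm, Real.sqrt_eq_iff_mul_self_eq (by positivity) (norm_nonneg _), ← pow_two,
    ← b.sum_sq_norm_inner_right, Fin.sum_univ_three]
  simp [inner_add_right, inner_smul_right, b.inner_eq_ite]

lemma exists_basis (x : E3) : ∃ b : OrthonormalBasis (Fin 3) ℝ E3, x = ‖x‖ • b 2 := by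
  by_cases hx : x = 0
  · exact ⟨EuclideanSpace.basisFun (Fin 3) ℝ, by simp [hx]⟩
  · have hu : ‖(‖x‖⁻¹ • x)‖ = 1 := by
      rw [norm_smul, norm_inv, norm_norm, inv_mul_cancel₀ (norm_ne_zero_iff.2 hx)]
    obtain ⟨b, hb⟩ := Orthonormal.exists_orthonormalBasis_extension_of_card_eq (𝕜 := ℝ) (E := E3)
      (ι := Fin 3) (by simp) (v := fun _ => ‖x‖⁻¹ • x) (s := {2}) (by
        constructor
        · intro i; exact hu
        · intro i j hij
          exact absurd (Subsingleton.elim i j) hij)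
    refine ⟨b, ?_⟩
    rw [hb 2 rfl, smul_smul, mul_inv_cancel₀ (norm_ne_zero_iff.2 hx), one_smul]

lemma pdd_eq (v : Spt → ℝ) (hv : ContDiff ℝ 2 v) (a b : Fin 4) (p : Spt) :
    pdd a b v p = fderiv ℝ (fderiv ℝ v) p (dir a) (dir b) := by
  have cV1 : ContDiff ℝ 1 (fderiv ℝ v) := hv.fderiv_right (by norm_num)
  have h := ((cV1.differentiable (by norm_num) p).hasFDerivAt.clm_apply
    (hasFDerivAt_const (dir b) p)).fderiv
  change fderiv ℝ (fun q => fderiv ℝ v q (dir b)) p (dir a) = _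
  rw [h]
  simp

lemma kirch (v : Spt → ℝ) (hv : ContDiff ℝ 2 v) (hbox : ∀ p : Spt, 0 ≤ p.1 → box v p = 0)
    (b : OrthonormalBasis (Fin 3) ℝ E3) (t : ℝ) (ht : 0 ≤ t) (x : E3) :
    ∫ θ in (0:ℝ)..Real.pi, ∫ φ in (0:ℝ)..(2 * Real.pi),
      Real.sin θ * (v (0, x + t • sph b θ φ) +
        t * fderiv ℝ v (0, x + t • sph b θ φ) (1, sph b θ φ)) = 4 * Real.pi * v (t, x) := by
  have hs : ∀ θ φ, sph (fun i => ((0:ℝ), b i)) θ φ = ((0:ℝ), sph b θ φ) := by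
    intro θ φ
    simp [sph]
  have h := kirchhoff_abs v hv ((1:ℝ), (0:E3)) ((0:ℝ), x) (fun i => ((0:ℝ), b i)) t ht ?_
  · simpa [hs] using h
  · intro s hs' θ φ
    set P := (t - s) • ((1:ℝ), (0:E3)) + ((0:ℝ), x) + s • sph (fun i => ((0:ℝ), b i)) θ φ with hP
    have hP0 : 0 ≤ P.1 := by
      rw [hP, hs]; simp; exact hs'.2
    have hb := hbox P hP0
    simp only [box, pdd_eq v hv] at hb
    have ht := trace_inv ((fderiv ℝ (fderiv ℝ v) P).bilinearComp (ContinuousLinearMap.inr ℝ ℝ E3)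
      (ContinuousLinearMap.inr ℝ ℝ E3)) b (EuclideanSpace.basisFun (Fin 3) ℝ)
    simp only [ContinuousLinearMap.bilinearComp_apply, ContinuousLinearMap.inr_apply,
      EuclideanSpace.basisFun_apply] at ht
    rw [ht]
    simp only [dir, Fin.cases_zero, Fin.cases_succ] at hb
    linarith

/-- **Weighted decay for the homogeneous wave equation** (Lemma 9.3, via Kirchhoff's formula).
If `□v = 0` on `[0,∞) × ℝ³` with data `v₀, v₁` then
`(1+t+|x|)⟨(|x|-t)₊⟩^γ |v(t,x)| ≤ C sup_y ((1+|y|)^{2+γ}(|v₁|+|∇v₀|) + (1+|y|)^{1+γ}|v₀|)`. -/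
theorem homogeneous_wave_decay (γ : ℝ) (hγ : 0 < γ) :
    ∃ C : ℝ, 0 < C ∧
      ∀ (v : Spt → ℝ) (v₀ v₁ : E3 → ℝ),
        ContDiff ℝ 2 v →
        (∀ p : Spt, 0 ≤ p.1 → box v p = 0) →
        (∀ x : E3, v (0, x) = v₀ x) →
        (∀ x : E3, pd 0 v (0, x) = v₁ x) →
        ∀ B : ℝ,
          (∀ y : E3,
            (1 + ‖y‖) ^ (2 + γ) * (|v₁ y| + ‖fderiv ℝ v₀ y‖)
              + (1 + ‖y‖) ^ (1 + γ) * |v₀ y| ≤ B) →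
          ∀ (t : ℝ), 0 ≤ t → ∀ x : E3,
            (1 + t + ‖x‖) * (1 + max (‖x‖ - t) 0) ^ γ * |v (t, x)| ≤ C * B := by
  have hCpos : 0 < 3 * 2 ^ (γ / 2) / γ := by positivity
  refine ⟨24 + (9 + 3 * 2 ^ (γ / 2) / γ), by positivity, ?_⟩
  intro v v₀ v₁ hv hbox h0 h1 B hB t ht x
  have hB0 : 0 ≤ B := le_trans (by positivity) (hB 0)
  obtain ⟨b, hb⟩ := exists_basis x
  have hk := kirch v hv hbox b t ht x
  set r := ‖x‖ with hr
  have hr0 : 0 ≤ r := norm_nonneg _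
  have hy : ∀ θ φ, ‖x + t • sph b θ φ‖ = rho r t θ := by
    intro θ φ
    have : x + t • sph b θ φ = (t * (Real.sin θ * Real.cos φ)) • b 0 +
        (t * (Real.sin θ * Real.sin φ)) • b 1 + (r + t * Real.cos θ) • b 2 := by
      conv_lhs => rw [hb]
      simp only [sph]; module
    rw [this, norm_comb, rho]
    congr 1
    have c1 := Real.sin_sq_add_cos_sq θ
    have c2 := Real.sin_sq_add_cos_sq φ
    linear_combination t ^ 2 * c1 + t ^ 2 * Real.sin θ ^ 2 * c2
  have hω : ∀ θ φ, ‖sph b θ φ‖ = 1 := by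
    intro θ φ
    rw [sph, norm_comb, Real.sqrt_eq_one]
    have c1 := Real.sin_sq_add_cos_sq θ
    have c2 := Real.sin_sq_add_cos_sq φ
    linear_combination c1 + Real.sin θ ^ 2 * c2
  have hpt : ∀ y w : E3, ‖w‖ = 1 → |v (0, y) + t * fderiv ℝ v (0, y) (1, w)| ≤
      B * ((1 + ‖y‖) ^ (-(1 + γ)) + t * (1 + ‖y‖) ^ (-(2 + γ))) := by
    intro y w hw
    have e1 : fderiv ℝ v (0, y) (1, w) = v₁ y + fderiv ℝ v₀ y w := by
      have : ((1:ℝ), w) = ((1:ℝ), (0:E3)) + ((0:ℝ), w) := by simp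
      rw [this, map_add]
      congr 1
      · exact h1 y
      · have hd : HasFDerivAt v (fderiv ℝ v (0, y)) (0, y) :=
          (hv.differentiable (by norm_num) _).hasFDerivAt
        have h2 := hd.comp y (hasFDerivAt_prodMk_right (𝕜 := ℝ) (0:ℝ) y)
        have h3 : v ∘ (fun y => ((0:ℝ), y)) = v₀ := funext h0
        rw [h3] at h2
        rw [h2.fderiv]; simp
    rw [h0, e1]
    have e2 : |fderiv ℝ v₀ y w| ≤ ‖fderiv ℝ v₀ y‖ := by
      have := (fderiv ℝ v₀ y).le_opNorm w
      rwa [hw, mul_one] at this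
    have hy1 : 0 < 1 + ‖y‖ := by positivity
    have q1 : (1 + ‖y‖) ^ (1 + γ) * |v₀ y| ≤ B := le_trans (le_add_of_nonneg_left (by positivity)) (hB y)
    have q2 : (1 + ‖y‖) ^ (2 + γ) * (|v₁ y| + ‖fderiv ℝ v₀ y‖) ≤ B :=
      le_trans (le_add_of_nonneg_right (by positivity)) (hB y)
    have q3 : |v₀ y| ≤ B * (1 + ‖y‖) ^ (-(1 + γ)) := by
      rw [Real.rpow_neg hy1.le, ← div_eq_mul_inv, le_div_iff₀ (by positivity)]; linarith
    have q4 : |v₁ y| + ‖fderiv ℝ v₀ y‖ ≤ B * (1 + ‖y‖) ^ (-(2 + γ)) := by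
      rw [Real.rpow_neg hy1.le, ← div_eq_mul_inv, le_div_iff₀ (by positivity)]; linarith
    calc _ ≤ |v₀ y| + |t * (v₁ y + fderiv ℝ v₀ y w)| := abs_add_le _ _
      _ = |v₀ y| + t * |v₁ y + fderiv ℝ v₀ y w| := by rw [abs_mul, abs_of_nonneg ht]
      _ ≤ |v₀ y| + t * (|v₁ y| + ‖fderiv ℝ v₀ y‖) := by
        gcongr; exact (abs_add_le _ _).trans (by gcongr)
      _ ≤ B * (1 + ‖y‖) ^ (-(1 + γ)) + t * (B * (1 + ‖y‖) ^ (-(2 + γ))) := by gcongr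
      _ = _ := by ring
  have hpi := Real.pi_pos
  have hin : ∀ θ ∈ Set.Ioc 0 Real.pi, ‖∫ φ in (0:ℝ)..(2 * Real.pi),
      Real.sin θ * (v (0, x + t • sph b θ φ) +
        t * fderiv ℝ v (0, x + t • sph b θ φ) (1, sph b θ φ))‖ ≤ (2 * Real.pi * B) *
      (Real.sin θ * ((1 + rho r t θ) ^ (-(1 + γ)) + t * (1 + rho r t θ) ^ (-(2 + γ)))) := by
    intro θ hθ
    have hs := Real.sin_nonneg_of_mem_Icc ⟨hθ.1.le, hθ.2⟩
    refine (intervalIntegral.norm_integral_le_of_norm_le_const (C := Real.sin θ * (B *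
      ((1 + rho r t θ) ^ (-(1 + γ)) + t * (1 + rho r t θ) ^ (-(2 + γ))))) ?_).trans (le_of_eq ?_)
    · intro φ _
      rw [norm_mul, Real.norm_of_nonneg hs, Real.norm_eq_abs, ← hy θ φ]
      exact mul_le_mul_of_nonneg_left (hpt _ _ (hω θ φ)) hs
    · rw [sub_zero, abs_of_pos (by positivity)]; ring
  have hout := intervalIntegral.norm_integral_le_of_norm_le hpi.le
    (Filter.Eventually.of_forall hin) ((J_int γ r t).const_mul _)
  rw [hk, intervalIntegral.integral_const_mul, norm_mul, Real.norm_of_nonneg (by positivity),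
    Real.norm_eq_abs] at hout
  have hJ := J_bound γ r t hγ hr0 ht
  set J := ∫ θ in (0:ℝ)..Real.pi, Real.sin θ *
    ((1 + rho r t θ) ^ (-(1 + γ)) + t * (1 + rho r t θ) ^ (-(2 + γ))) with hJdef
  set W := (1 + t + r) * (1 + max (r - t) 0) ^ γ with hW
  have hW0 : 0 ≤ W := by positivity
  have hv2 : 2 * |v (t, x)| ≤ B * J := by
    have : (2 * Real.pi) * (2 * |v (t, x)|) ≤ (2 * Real.pi) * (B * J) := by linarith
    exact le_of_mul_le_mul_left this (by positivity)
  have h3 := mul_le_mul_of_nonneg_left hv2 hW0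
  have h4 := mul_le_mul_of_nonneg_left hJ hB0
  have h5 : 0 ≤ W * |v (t, x)| := by positivity
  linarith
end
end

section
/- Let K, M₀, M, N ≥ 0 be integers and let ψ be a finite sum of the form ψ = Σ_{k≤K, m≤M₀} (ln r)^m r^{−N} (t/r)^k χ_{kmN}(ω, r/(t+1)) + Σ_{k≤K, m≤M, n≥N+1} (ln r)^m r^{−n} (t/r)^k χ_{kmn}(ω, r/(t+1)), where each χ_{kmn}(ω,y) is a smooth function on S²×ℝ supported in {y≥1/4} and such that ∂_yχ_{kmn}(ω,y) is supported in {y≤3/4}. Then for every multiindex α and every multiindex I there are constants C_α, C_I such that for all t≥0 and x≠0: |∂^αψ(t,x)| ≤ C_α ⟨ln r⟩^{M₀} r^{−N−|α|} and |Z^Iψ(t,x)| ≤ C_I ⟨ln r⟩^{M₀} r^{−N}. -/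
noncomputable section
open MeasureTheory

section Helpers
open scoped ContDiff

/-- Working open region. -/
def RU : Set Spt := {p | -(1/2:ℝ) < p.1 ∧ p.2 ≠ 0}
/-- Region containing the support. -/
def RV : Set Spt := {p | p ∈ RU ∧ p.1 + 1 ≤ 4 * ‖p.2‖}

lemma RU_open : IsOpen RU := by
  unfold RU
  exact (isOpen_lt continuous_const continuous_fst).inter
    (isOpen_ne_fun continuous_snd continuous_const)

lemma RU_uniq : UniqueDiffOn ℝ RU := RU_open.uniqueDiffOn

lemma RV_r {p : Spt} (h : p ∈ RV) : 1/8 ≤ ‖p.2‖ := by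
  have h1 := h.1.1
  have h2 := h.2
  linarith

lemma RU_r {p : Spt} (h : p ∈ RU) : 0 < ‖p.2‖ := norm_pos_iff.2 h.2

/-- Symbol class. -/
def Sy {F : Type} [NormedAddCommGroup F] [NormedSpace ℝ F] (M : ℕ) (d : ℤ) (f : Spt → F) : Prop :=
  ContDiffOn ℝ ∞ f RU ∧ ∀ j : ℕ, ∃ C : ℝ, 0 ≤ C ∧ ∀ p ∈ RV,
    ‖iteratedFDerivWithin ℝ j f RU p‖ ≤ C * (1 + |Real.log ‖p.2‖|) ^ M * ‖p.2‖ ^ (d - j)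

lemma natle (j : ℕ) : ((j : ℕ∞ω)) ≤ ∞ := by exact_mod_cast le_top

section
variable {F : Type} [NormedAddCommGroup F] [NormedSpace ℝ F]
variable {G : Type} [NormedAddCommGroup G] [NormedSpace ℝ G]

lemma Sy.congr {M : ℕ} {d : ℤ} {f g : Spt → F} (hf : Sy M d f) (h : Set.EqOn g f RU) :
    Sy M d g := by
  refine ⟨hf.1.congr h, fun j => ?_⟩
  obtain ⟨C, hC, hb⟩ := hf.2 j
  refine ⟨C, hC, fun p hp => ?_⟩
  rw [iteratedFDerivWithin_congr h hp.1]
  exact hb p hp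

lemma Sy.add {M : ℕ} {d : ℤ} {f g : Spt → F} (hf : Sy M d f) (hg : Sy M d g) :
    Sy M d (fun p => f p + g p) := by
  refine ⟨hf.1.add hg.1, fun j => ?_⟩
  obtain ⟨C, hC, hb⟩ := hf.2 j
  obtain ⟨C', hC', hb'⟩ := hg.2 j
  refine ⟨C + C', by positivity, fun p hp => ?_⟩
  have := iteratedFDerivWithin_add_apply (i := j) ((hf.1.of_le (natle j)) p hp.1)
    ((hg.1.of_le (natle j)) p hp.1) RU_uniq hp.1
  change ‖iteratedFDerivWithin ℝ j (f + g) RU p‖ ≤ _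
  rw [this]
  refine (norm_add_le _ _).trans ?_
  have := hb p hp
  have := hb' p hp
  linarith

lemma Sy.zero (M : ℕ) (d : ℤ) : Sy M d (fun _ => (0:F)) := by
  refine ⟨contDiffOn_const, fun j => ⟨0, le_rfl, fun p hp => ?_⟩⟩
  simp

lemma Sy.sum {ι : Type} {M : ℕ} {d : ℤ} (s : Finset ι) {f : ι → Spt → F}
    (h : ∀ i ∈ s, Sy M d (f i)) : Sy M d (fun p => ∑ i ∈ s, f i p) := by
  classical
  induction s using Finset.induction_on with
  | empty => simpa using Sy.zero M d
  | insert a s ha ih =>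
    simp only [Finset.sum_insert ha]
    exact (h a (by simp)).add (ih fun i hi => h i (by simp [hi]))

lemma Sy.clm {M : ℕ} {d : ℤ} {f : Spt → F} (hf : Sy M d f) (L : F →L[ℝ] G) :
    Sy M d (fun p => L (f p)) := by
  refine ⟨L.contDiff.comp_contDiffOn hf.1, fun j => ?_⟩
  obtain ⟨C, hC, hb⟩ := hf.2 j
  refine ⟨‖L‖ * C, by positivity, fun p hp => ?_⟩
  refine (L.norm_iteratedFDerivWithin_comp_left (hf.1 p hp.1) RU_uniq hp.1 (natle j)).trans ?_
  rw [mul_assoc, mul_assoc, ← mul_assoc C]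
  exact mul_le_mul_of_nonneg_left (hb p hp) (norm_nonneg _)

lemma Sy.deriv {M : ℕ} {d : ℤ} {f : Spt → F} (hf : Sy M d f) (v : Spt) :
    Sy M (d-1) (fun p => fderiv ℝ f p v) := by
  have h1 : Sy M (d-1) (fun p => fderivWithin ℝ f RU p) := by
    refine ⟨hf.1.fderivWithin RU_uniq (by simp), fun j => ?_⟩
    obtain ⟨C, hC, hb⟩ := hf.2 (j+1)
    refine ⟨C, hC, fun p hp => ?_⟩
    have := norm_iteratedFDerivWithin_fderivWithin (𝕜 := ℝ) (f := f) (n := j) RU_uniq hp.1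
    refine this.le.trans ((hb p hp).trans (le_of_eq ?_))
    congr 2
    push_cast; ring
  refine (h1.clm (ContinuousLinearMap.apply ℝ F v)).congr fun p hp => ?_
  simp [fderivWithin_of_isOpen RU_open hp]

lemma Sy.mono {M M' : ℕ} {d : ℤ} {f : Spt → F} (hf : Sy M d f) (h : M ≤ M') : Sy M' d f := by
  refine ⟨hf.1, fun j => ?_⟩
  obtain ⟨C, hC, hb⟩ := hf.2 j
  refine ⟨C, hC, fun p hp => (hb p hp).trans ?_⟩
  have : (1:ℝ) ≤ 1 + |Real.log ‖p.2‖| := by simp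
  gcongr

lemma log_bd (M : ℕ) (k : ℕ) : ∃ C : ℝ, 0 ≤ C ∧ ∀ r : ℝ, 1/8 ≤ r →
    (1 + |Real.log r|) ^ M ≤ C * r ^ (k+1) := by
  refine ⟨M.factorial * (Real.exp 1 * 64) * 8 ^ k, by positivity, fun r hr => ?_⟩
  have hr0 : 0 < r := by linarith
  have h1 := Real.pow_div_factorial_le_exp (1 + |Real.log r|) (by positivity) M
  rw [div_le_iff₀ (by positivity), Real.exp_add] at h1
  have h2 : Real.exp |Real.log r| ≤ 64 * r := by
    rcases abs_cases (Real.log r) with h | h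
    · rw [h.1, Real.exp_log hr0]; linarith
    · rw [h.1, Real.exp_neg, Real.exp_log hr0, inv_le_iff_one_le_mul₀ hr0]; nlinarith
  have h3 : 1 ≤ 8 ^ k * r ^ k := by
    rw [← mul_pow]; exact one_le_pow₀ (by linarith)
  calc (1 + |Real.log r|) ^ M ≤ Real.exp 1 * Real.exp |Real.log r| * M.factorial := h1
    _ ≤ Real.exp 1 * (64 * r) * M.factorial := by gcongr
    _ = (Real.exp 1 * (64 * r) * M.factorial) * 1 := by ring
    _ ≤ (Real.exp 1 * (64 * r) * M.factorial) * (8 ^ k * r ^ k) := by gcongr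
    _ = _ := by ring

lemma Sy.weak {M : ℕ} {d d' : ℤ} {f : Spt → F} (hf : Sy M d f) (h : d < d') (M' : ℕ) :
    Sy M' d' f := by
  refine Sy.mono (M := 0) ?_ (Nat.zero_le _)
  refine ⟨hf.1, fun j => ?_⟩
  obtain ⟨C, hC, hb⟩ := hf.2 j
  obtain ⟨k, hk⟩ : ∃ k : ℕ, d' = d + (k+1 : ℕ) := ⟨(d' - d - 1).toNat, by omega⟩
  obtain ⟨C', hC', hb'⟩ := log_bd M k
  refine ⟨C * C', by positivity, fun p hp => (hb p hp).trans ?_⟩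
  have hr := RU_r hp.1
  have e : ‖p.2‖ ^ (d' - j) = ‖p.2‖ ^ (k+1) * ‖p.2‖ ^ (d - j) := by
    rw [← zpow_natCast, ← zpow_add₀ hr.ne']; congr 1; rw [hk]; ring
  rw [e, pow_zero, mul_one]
  calc _ ≤ C * (C' * ‖p.2‖ ^ (k+1)) * ‖p.2‖ ^ (d - j) := by
        gcongr; exact hb' _ (RV_r hp)
    _ = _ := by ring

lemma Sy.mul {M M' : ℕ} {d d' : ℤ} {f g : Spt → ℝ} (hf : Sy M d f) (hg : Sy M' d' g) :
    Sy (M + M') (d + d') (fun p => f p * g p) := by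
  refine ⟨hf.1.mul hg.1, fun j => ?_⟩
  choose C hC hb using hf.2
  choose C' hC' hb' using hg.2
  refine ⟨∑ i ∈ Finset.range (j+1), (j.choose i : ℝ) * C i * C' (j - i),
    Finset.sum_nonneg fun i _ => by have := hC i; have := hC' (j-i); positivity, fun p hp => ?_⟩
  refine (norm_iteratedFDerivWithin_mul_le hf.1 hg.1 RU_uniq hp.1 (natle j)).trans ?_
  rw [Finset.sum_mul, Finset.sum_mul]
  refine Finset.sum_le_sum fun i hi => ?_
  have hr := RU_r hp.1
  have hij : i ≤ j := by simpa [Nat.lt_succ_iff] using hi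
  have e : ‖p.2‖ ^ (d + d' - j) = ‖p.2‖ ^ (d - i) * ‖p.2‖ ^ (d' - (j - i : ℕ)) := by
    rw [← zpow_add₀ hr.ne']; congr 1; push_cast [hij]; ring
  have h1 := hb i p hp
  have h2 := hb' (j-i) p hp
  have := hC i
  calc _ ≤ (j.choose i : ℝ) * (C i * (1 + |Real.log ‖p.2‖|) ^ M * ‖p.2‖ ^ (d - i))
        * (C' (j-i) * (1 + |Real.log ‖p.2‖|) ^ M' * ‖p.2‖ ^ (d' - (j-i : ℕ))) := by
        gcongr
    _ = _ := by rw [e, pow_add]; ring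

lemma Sy.const (c : F) : Sy 0 0 (fun _ => c) := by
  refine ⟨contDiffOn_const, fun j => ⟨‖c‖, norm_nonneg _, fun p hp => ?_⟩⟩
  rcases Nat.eq_zero_or_pos j with rfl | h
  · simp
  · rw [iteratedFDerivWithin_const_of_ne (by omega)]
    simp; positivity

lemma Sy.pow {M : ℕ} {d : ℤ} {f : Spt → ℝ} (hf : Sy M d f) (n : ℕ) :
    Sy (n * M) (n * d) (fun p => f p ^ n) := by
  induction n with
  | zero => simpa using Sy.const (1:ℝ)
  | succ n ih =>
    have := ih.mul hf
    simp only [pow_succ]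
    convert this using 1
    · ring
    · push_cast; ring

lemma lin_bd (L : Spt →L[ℝ] F) (i : ℕ) (hi : 1 ≤ i) {p : Spt} (hp : p ∈ RU) :
    ‖iteratedFDerivWithin ℝ i L RU p‖ ≤ ‖L‖ ^ i := by
  obtain ⟨n, rfl⟩ : ∃ n, i = n + 1 := ⟨i - 1, by omega⟩
  rw [← norm_iteratedFDerivWithin_fderivWithin RU_uniq hp]
  have : Set.EqOn (fderivWithin ℝ L RU) (fun _ => L) RU := fun q hq => by
    rw [L.fderivWithin (RU_uniq q hq)]
  rw [iteratedFDerivWithin_congr this hp]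
  rcases Nat.eq_zero_or_pos n with rfl | h
  · simp
  · rw [iteratedFDerivWithin_const_of_ne (by omega)]
    simp

/-- Linear maps bounded by `r` on `RV`. -/
lemma Sy.lin (L : Spt →L[ℝ] F) (c : ℝ) (hc : 0 ≤ c) (h : ∀ p ∈ RV, ‖L p‖ ≤ c * ‖p.2‖) :
    Sy 0 1 (fun p => L p) := by
  refine ⟨L.contDiff.contDiffOn, fun j => ?_⟩
  rcases Nat.lt_trichotomy j 1 with hj | hj | hj
  · obtain rfl : j = 0 := by omega
    exact ⟨c, hc, fun p hp => by simpa using h p hp⟩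
  · subst hj
    exact ⟨‖L‖, norm_nonneg _, fun p hp => by simpa using lin_bd L 1 le_rfl hp.1⟩
  · refine ⟨0, le_rfl, fun p hp => ?_⟩
    obtain ⟨n, rfl⟩ : ∃ n, j = n + 1 := ⟨j - 1, by omega⟩
    have : Set.EqOn (fderivWithin ℝ L RU) (fun _ => L) RU := fun q hq => by
      rw [L.fderivWithin (RU_uniq q hq)]
    have := norm_iteratedFDerivWithin_fderivWithin (𝕜 := ℝ) (f := L) (n := n) RU_uniq hp.1
    rw [← this]
    rw [iteratedFDerivWithin_congr ‹Set.EqOn _ _ _› hp.1, iteratedFDerivWithin_const_of_ne (by omega)]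
    simp

lemma hom_bd {g : E3 → F} (hg : ContDiffOn ℝ ∞ g {0}ᶜ) (d : ℤ) (c : ℝ → F)
    (hh : ∀ l : ℝ, 0 < l → ∀ x : E3, x ≠ 0 → g (l • x) = l ^ d • g x + c l)
    (j : ℕ) (hj : j ≠ 0 ∨ ∀ l, c l = 0) :
    ∃ C : ℝ, 0 ≤ C ∧ ∀ p ∈ RU,
      ‖iteratedFDerivWithin ℝ j (fun q : Spt => g q.2) RU p‖ ≤ C * ‖p.2‖ ^ (d - j) := by
  have hop : IsOpen ({0}ᶜ : Set E3) := isOpen_compl_singleton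
  have hb : ∀ i : ℕ, ∃ B : ℝ, ∀ x ∈ Metric.sphere (0:E3) 1,
      ‖iteratedFDerivWithin ℝ i g {0}ᶜ x‖ ≤ B := fun i => by
    refine (isCompact_sphere (0:E3) 1).exists_bound_of_continuousOn ?_
    refine (hg.continuousOn_iteratedFDerivWithin (natle i) hop.uniqueDiffOn).mono ?_
    intro x hx hx0
    simp at hx hx0
    simp [hx0] at hx
  choose B hB using hb
  have hC : ∀ i ≤ j, B i ≤ ∑ i ∈ Finset.range (j+1), |B i| := fun i hi =>
    (le_abs_self _).trans
      (Finset.single_le_sum (f := fun i => |B i|) (fun _ _ => abs_nonneg _) (by simp; omega))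
  set C := ∑ i ∈ Finset.range (j+1), |B i| with hCdef
  have hC0 : 0 ≤ C := Finset.sum_nonneg fun _ _ => abs_nonneg _
  refine ⟨j.factorial * C, by positivity, fun p hp => ?_⟩
  have hr := RU_r hp
  set l := ‖p.2‖ with hl
  let L : Spt →L[ℝ] E3 := l⁻¹ • ContinuousLinearMap.snd ℝ ℝ E3
  have hLn : ‖L‖ ≤ l⁻¹ := by
    refine (norm_smul_le (l⁻¹) (ContinuousLinearMap.snd ℝ ℝ E3)).trans ?_
    rw [norm_inv, Real.norm_of_nonneg hr.le]
    exact mul_le_of_le_one_right (by positivity) (ContinuousLinearMap.norm_snd_le _ _ _)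
  have hmaps : Set.MapsTo L RU ({0}ᶜ : Set E3) := fun q hq => by
    simp [L, hr.ne', hq.2]
  have hcomp : ContDiffOn ℝ ∞ (g ∘ L) RU := hg.comp L.contDiff.contDiffOn hmaps
  have key : ‖iteratedFDerivWithin ℝ j (g ∘ L) RU p‖ ≤ j.factorial * C * (l⁻¹) ^ j := by
    refine norm_iteratedFDerivWithin_comp_le hg L.contDiff.contDiffOn (natle j)
      hop.uniqueDiffOn RU_uniq hmaps hp (fun i hi => (hB i _ ?_).trans (hC i hi)) (fun i hi _ => ?_)
    · simp [L, norm_smul, ← hl, abs_of_pos hr, hr.ne']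
    · exact (lin_bd L i hi hp).trans (by gcongr)
  have heq : Set.EqOn (fun q : Spt => g q.2) ((l ^ d • (g ∘ L)) + fun _ => c l) RU := fun q hq => by
    have := hh l hr (l⁻¹ • q.2) (by simp [hr.ne', hq.2])
    rw [smul_inv_smul₀ hr.ne'] at this
    simpa [L] using this
  rw [iteratedFDerivWithin_congr heq hp]
  have hcj := (hcomp.of_le (natle j)) p hp
  have hsm : ContDiffWithinAt ℝ j (l ^ d • (g ∘ L)) RU p := hcj.const_smul _
  rw [iteratedFDerivWithin_add_apply hsm contDiffWithinAt_const RU_uniq hp]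
  have hz : iteratedFDerivWithin ℝ j (fun _ : Spt => c l) RU p = 0 := by
    rcases hj with hj | hj
    · rw [iteratedFDerivWithin_const_of_ne hj]; rfl
    · rw [hj]; simp
  rw [hz, add_zero, iteratedFDerivWithin_const_smul_apply hcj RU_uniq hp, norm_smul,
    Real.norm_of_nonneg (by positivity)]
  calc _ ≤ l ^ d * (j.factorial * C * (l⁻¹) ^ j) := by gcongr
    _ = _ := by rw [zpow_sub₀ hr.ne', zpow_natCast, inv_pow]; ring

lemma Sy.comp {g : G → F} (hg : ContDiff ℝ ∞ g) {f : Spt → G} (hf : Sy 0 0 f)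
    {K : Set G} (hK : IsCompact K) (hfK : ∀ p ∈ RV, f p ∈ K) : Sy 0 0 (fun p => g (f p)) := by
  refine ⟨hg.comp_contDiffOn hf.1, fun j => ?_⟩
  have hb : ∀ i : ℕ, ∃ B : ℝ, ∀ x ∈ K, ‖iteratedFDerivWithin ℝ i g Set.univ x‖ ≤ B := fun i => by
    refine hK.exists_bound_of_continuousOn ?_
    exact (hg.contDiffOn.continuousOn_iteratedFDerivWithin (natle i) uniqueDiffOn_univ).mono
      (Set.subset_univ _)
  choose B hB using hb
  choose D hD0 hD using hf.2
  have hC : ∀ i ≤ j, B i ≤ ∑ i ∈ Finset.range (j+1), |B i| := fun i hi =>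
    (le_abs_self _).trans
      (Finset.single_le_sum (f := fun i => |B i|) (fun _ _ => abs_nonneg _) (by simp; omega))
  set C := ∑ i ∈ Finset.range (j+1), |B i| with hCdef
  have hC0 : 0 ≤ C := Finset.sum_nonneg fun _ _ => abs_nonneg _
  have hE : ∀ i ≤ j, D i ≤ 1 + ∑ i ∈ Finset.range (j+1), D i := fun i hi => by
    have := Finset.single_le_sum (f := D) (s := Finset.range (j+1)) (fun i _ => hD0 i)
      (a := i) (by simp; omega)
    linarith
  set E := 1 + ∑ i ∈ Finset.range (j+1), D i with hEdef
  have hE1 : 1 ≤ E := by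
    have := Finset.sum_nonneg (s := Finset.range (j+1)) (fun i _ => hD0 i); linarith
  refine ⟨j.factorial * C * E ^ j, by positivity, fun p hp => ?_⟩
  have hr := RU_r hp.1
  refine (norm_iteratedFDerivWithin_comp_le (D := E * ‖p.2‖⁻¹) (C := C) hg.contDiffOn hf.1 (natle j)
      uniqueDiffOn_univ RU_uniq (Set.mapsTo_univ _ _) hp.1
      (fun i hi => (hB i _ (hfK p hp)).trans (hC i hi)) (fun i hi hij => ?_)).trans (le_of_eq ?_)
  · refine (hD i p hp).trans ?_
    rw [mul_pow, pow_zero, mul_one, zero_sub, zpow_neg, zpow_natCast, inv_pow]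
    gcongr
    exact (hE i hij).trans (le_self_pow₀ hE1 (by omega))
  · rw [mul_pow, pow_zero, mul_one, zero_sub, zpow_neg, zpow_natCast, inv_pow]
    ring

end

lemma norm_smooth : ContDiffOn ℝ ∞ (fun x : E3 => ‖x‖) {0}ᶜ := fun _ hx =>
  (contDiffAt_norm ℝ hx).contDiffWithinAt

lemma ninv_smooth : ContDiffOn ℝ ∞ (fun x : E3 => ‖x‖⁻¹) {0}ᶜ :=
  norm_smooth.inv fun _ hx => by simpa using hx

lemma snd_maps : Set.MapsTo (Prod.snd : Spt → E3) RU ({0}ᶜ : Set E3) := fun _ hq => hq.2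

lemma Sy_inv : Sy 0 (-1) (fun p => ‖p.2‖⁻¹) := by
  refine ⟨ninv_smooth.comp contDiff_snd.contDiffOn snd_maps, fun j => ?_⟩
  obtain ⟨C, hC, hb⟩ := hom_bd ninv_smooth (-1) (fun _ => 0) (fun l hl x hx => by
    simp [norm_smul, abs_of_pos hl, mul_comm]) j (Or.inr fun _ => rfl)
  exact ⟨C, hC, fun p hp => by simpa using hb p hp.1⟩

lemma Sy_omg : Sy 0 0 omg := by
  have hs : ContDiffOn ℝ ∞ (fun x : E3 => ‖x‖⁻¹ • x) {0}ᶜ := ninv_smooth.smul contDiffOn_id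
  refine ⟨hs.comp contDiff_snd.contDiffOn snd_maps, fun j => ?_⟩
  obtain ⟨C, hC, hb⟩ := hom_bd hs 0 (fun _ => 0) (fun l hl x hx => by
    simp only [norm_smul, Real.norm_of_nonneg hl.le, smul_smul, zpow_zero, one_smul, add_zero]
    congr 1
    field_simp) j (Or.inr fun _ => rfl)
  refine ⟨C, hC, fun p hp => ?_⟩
  rw [pow_zero, mul_one]
  exact hb p hp.1

lemma Sy_log : Sy 1 0 (fun p => Real.log ‖p.2‖) := by
  have hs : ContDiffOn ℝ ∞ (fun x : E3 => Real.log ‖x‖) {0}ᶜ :=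
    norm_smooth.log fun _ hx => by simpa using hx
  refine ⟨hs.comp contDiff_snd.contDiffOn snd_maps, fun j => ?_⟩
  rcases Nat.eq_zero_or_pos j with rfl | hj
  · exact ⟨1, zero_le_one, fun p hp => by simp⟩
  obtain ⟨C, hC, hb⟩ := hom_bd hs 0 (fun l => Real.log l) (fun l hl x hx => by
    simp only [norm_smul, Real.norm_of_nonneg hl.le, zpow_zero, one_smul]
    rw [Real.log_mul hl.ne' (by simpa using hx), add_comm]) j (Or.inl (by omega))
  refine ⟨C, hC, fun p hp => (hb p hp.1).trans ?_⟩
  have hr := RU_r hp.1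
  have : C ≤ C * (1 + |Real.log ‖p.2‖|) ^ 1 :=
    le_mul_of_one_le_right hC (by simp)
  gcongr

lemma Sy_t : Sy 0 1 (fun p => p.1) :=
  Sy.lin (ContinuousLinearMap.fst ℝ ℝ E3) 4 (by norm_num) fun p hp => by
    have h1 := hp.1.1
    have h2 := hp.2
    simp only [ContinuousLinearMap.coe_fst', Real.norm_eq_abs]
    rw [abs_le]; constructor <;> linarith

lemma Sy_x (i : Fin 3) : Sy 0 1 (fun p => p.2 i) :=
  Sy.lin ((EuclideanSpace.proj i : E3 →L[ℝ] ℝ).comp (ContinuousLinearMap.snd ℝ ℝ E3)) 1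
    (by norm_num) fun p hp => by
    simpa using PiLp.norm_apply_le p.2 i

lemma Sy_tr : Sy 0 0 (fun p => p.1 / ‖p.2‖) := by
  simpa [div_eq_mul_inv] using Sy_t.mul Sy_inv

lemma chi_ext (χ : E3 × ℝ → ℝ) (hs : ContDiff ℝ ∞ χ)
    (hd : ∀ (w : E3) (y : ℝ), 3/4 < y → deriv (fun s => χ (w, s)) y = 0) :
    ∃ g : E3 × ℝ → ℝ, ContDiff ℝ ∞ g ∧ ∀ (w : E3) (s : ℝ), 0 < s → g (w, s) = χ (w, s⁻¹) := by
  have hc : ∀ (w : E3) (y : ℝ), 3/4 < y → χ (w, y) = χ (w, 1) := fun w y hy => by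
    have hdiff : Differentiable ℝ (fun s => χ (w, s)) :=
      (hs.comp (contDiff_const.prodMk contDiff_id)).differentiable (by simp)
    exact isOpen_Ioi.is_const_of_deriv_eq_zero (s := Set.Ioi (3/4:ℝ)) isPreconnected_Ioi
      hdiff.differentiableOn (fun z hz => hd w z hz) hy (by norm_num)
  have hpos : ∀ (w : E3) (s : ℝ), 0 < s → s < 4/3 → χ (w, s⁻¹) = χ (w, 1) := fun w s h1 h2 => by
    refine hc w _ ?_
    rw [lt_inv_comm₀ (by norm_num) h1]; norm_num; linarith
  refine ⟨fun q => if q.2 < 1 then χ (q.1, 1) else χ (q.1, q.2⁻¹), ?_, ?_⟩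
  · rw [contDiff_iff_contDiffAt]
    intro q
    by_cases hq : q.2 < 4/3
    · have h1 : ContDiffAt ℝ ∞ (fun q : E3 × ℝ => χ (q.1, 1)) q :=
        (hs.comp (contDiff_fst.prodMk contDiff_const)).contDiffAt
      refine h1.congr_of_eventuallyEq ?_
      filter_upwards [(isOpen_lt continuous_snd continuous_const).mem_nhds hq] with z hz
      split_ifs with h
      · rfl
      · exact hpos _ _ (by linarith) hz
    · have hq0 : 0 < q.2 := by linarith
      have h1 : ContDiffAt ℝ ∞ (fun q : E3 × ℝ => χ (q.1, q.2⁻¹)) q :=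
        hs.contDiffAt.comp q (contDiffAt_fst.prodMk (contDiffAt_snd.inv hq0.ne'))
      refine h1.congr_of_eventuallyEq ?_
      filter_upwards [(isOpen_lt continuous_const continuous_snd).mem_nhds hq0] with z hz
      split_ifs with h
      · exact (hpos _ _ hz (by linarith)).symm
      · rfl
  · intro w s h
    simp only
    split_ifs with h1
    · exact (hpos _ _ h (by linarith)).symm
    · rfl

lemma Sy_chi (χ : E3 × ℝ → ℝ) (hs : ContDiff ℝ ∞ χ)
    (hd : ∀ (w : E3) (y : ℝ), 3/4 < y → deriv (fun s => χ (w, s)) y = 0) :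
    Sy 0 0 (fun p => χ (omg p, ‖p.2‖ / (p.1 + 1))) := by
  obtain ⟨g, hg, hgx⟩ := chi_ext χ hs hd
  have h1 : Sy 0 0 (fun p : Spt => p.1 / ‖p.2‖ + ‖p.2‖⁻¹) :=
    Sy_tr.add (Sy_inv.weak (by norm_num) 0)
  have h2 : Sy 0 0 (fun p : Spt => (omg p, p.1 / ‖p.2‖ + ‖p.2‖⁻¹)) := by
    refine ((Sy_omg.clm (ContinuousLinearMap.inl ℝ E3 ℝ)).add
      (h1.clm (ContinuousLinearMap.inr ℝ E3 ℝ))).congr fun p hp => ?_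
    simp
  have h3 := Sy.comp hg h2 ((isCompact_sphere (0:E3) 1).prod (isCompact_Icc (a := (0:ℝ)) (b := 4)))
    (fun p hp => by
      have hr := RU_r hp.1
      have e : p.1 / ‖p.2‖ + ‖p.2‖⁻¹ = (p.1 + 1) / ‖p.2‖ := by field_simp
      have := hp.1.1
      refine ⟨?_, ?_, ?_⟩
      · simp [omg, norm_smul, hr.ne']
      · simp only [e]; exact div_nonneg (by linarith) hr.le
      · simp only [e]; rw [div_le_iff₀ hr]; exact hp.2)
  refine h3.congr fun p hp => ?_
  have hr := RU_r hp
  have e : p.1 / ‖p.2‖ + ‖p.2‖⁻¹ = (p.1 + 1) / ‖p.2‖ := by field_simp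
  have := hp.1
  simp only [e]
  rw [hgx _ _ (div_pos (by linarith) hr), inv_div]

lemma Sy_term (m n k : ℕ) (χ : E3 × ℝ → ℝ) (hs : ContDiff ℝ ∞ χ)
    (hd : ∀ (w : E3) (y : ℝ), 3/4 < y → deriv (fun s => χ (w, s)) y = 0) :
    Sy m (-n) (fun p => (Real.log ‖p.2‖)^m / ‖p.2‖^n * (p.1 / ‖p.2‖)^k
          * χ (omg p, ‖p.2‖ / (p.1 + 1))) := by
  have := (((Sy_log.pow m).mul (Sy_inv.pow n)).mul (Sy_tr.pow k)).mul (Sy_chi χ hs hd)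
  simpa [div_eq_mul_inv] using this

/-- Vanishing off the support region. -/
def Van (f : Spt → ℝ) : Prop := ∀ p ∈ RU, p ∉ RV → f p = 0

lemma Van.fd {f : Spt → ℝ} (hf : Van f) {p : Spt} (hp : p ∈ RU) (hq : p ∉ RV) :
    fderiv ℝ f p = 0 := by
  have h : f =ᶠ[nhds p] fun _ => 0 := by
    have ho : IsOpen {q : Spt | 4 * ‖q.2‖ < q.1 + 1} :=
      isOpen_lt (by fun_prop) (by fun_prop)
    have hm : p ∈ {q : Spt | 4 * ‖q.2‖ < q.1 + 1} := by
      by_contra h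
      exact hq ⟨hp, not_lt.1 h⟩
    filter_upwards [RU_open.mem_nhds hp, ho.mem_nhds hm] with z h1 h2
    exact hf z h1 fun h => absurd h.2 (not_le.2 h2)
  rw [h.fderiv_eq]; simp

lemma pdT_ok {M : ℕ} {d : ℤ} {f : Spt → ℝ} (hf : Sy M d f) (hv : Van f) :
    ∀ (j : ℕ) (β : Fin j → Fin 4), Sy M (d - j) (pdT β f) ∧ Van (pdT β f) := by
  intro j
  induction j with
  | zero => intro β; simpa [pdT] using ⟨hf, hv⟩
  | succ j ih =>
    intro β
    obtain ⟨h1, h2⟩ := ih (fun j => β j.succ)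
    refine ⟨?_, fun p hp hq => ?_⟩
    · have := h1.deriv (dir (β 0))
      rw [show d - ((j + 1 : ℕ) : ℤ) = d - j - 1 by push_cast; ring]
      exact this
    · simp [pdT, pd, h2.fd hp hq]

lemma Sy_zf (z : ZIdx) (a : Fin 4) : Sy 0 1 (fun p => zfield z p a) := by
  have hl : ∀ b : Fin 4, Sy 0 1 (fun p => xlow p b) := fun b => by
    refine Fin.cases ?_ (fun i => ?_) b
    · have := Sy_t.clm (-(ContinuousLinearMap.id ℝ ℝ))
      simpa [xlow] using this
    · simpa [xlow] using Sy_x i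
  have hu : ∀ b : Fin 4, Sy 0 1 (fun p => xup p b) := fun b => by
    refine Fin.cases ?_ (fun i => ?_) b
    · simpa [xup] using Sy_t
    · simpa [xup] using Sy_x i
  rcases z with b | ⟨b, c⟩ | u
  · exact (Sy.const _).weak (by norm_num) 0
  · have h1 := (hl b).mul (Sy.const (if a = c then (1:ℝ) else 0))
    have h2 := (hl c).mul (Sy.const (-(if a = b then (1:ℝ) else 0)))
    have := h1.add h2
    refine this.congr fun p _ => ?_
    simp only [zfield]; ring
  · exact hu a

lemma zApply_ok {M : ℕ} {d : ℤ} {f : Spt → ℝ} (hf : Sy M d f) (hv : Van f) :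
    ∀ (j : ℕ) (I : Fin j → ZIdx), Sy M d (zApply I f) ∧ Van (zApply I f) := by
  intro j
  induction j with
  | zero => intro β; simpa [zApply] using ⟨hf, hv⟩
  | succ j ih =>
    intro I
    obtain ⟨h1, h2⟩ := ih (fun j => I j.succ)
    refine ⟨?_, fun p hp hq => ?_⟩
    · have := Sy.sum Finset.univ (M := 0 + M) (d := 1 + (d - 1))
        (f := fun (a : Fin 4) p => zfield (I 0) p a *
          fderiv ℝ (zApply (fun j => I j.succ) f) p (dir a))
        (fun a _ => (Sy_zf (I 0) a).mul (h1.deriv (dir a)))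
      rw [zero_add, add_sub_cancel] at this
      refine this.congr fun p _ => ?_
      simp [zApply, toVec, map_sum]
    · simp [zApply, h2.fd hp hq]

lemma Sy_final {M n : ℕ} {f : Spt → ℝ} (hf : Sy M (-n) f) (hv : Van f) :
    ∃ C : ℝ, 0 < C ∧ ∀ p : Spt, 0 ≤ p.1 → p.2 ≠ 0 →
        |f p| ≤ C * (1 + |Real.log ‖p.2‖|)^M / ‖p.2‖^n := by
  obtain ⟨C, hC, hb⟩ := hf.2 0
  refine ⟨C + 1, by positivity, fun p h1 h2 => ?_⟩
  have hU : p ∈ RU := ⟨by linarith, h2⟩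
  have hr := RU_r hU
  by_cases hV : p ∈ RV
  · have := hb p hV
    simp only [norm_iteratedFDerivWithin_zero, Real.norm_eq_abs, Nat.cast_zero, sub_zero,
      zpow_neg, zpow_natCast] at this
    refine this.trans ?_
    rw [← div_eq_mul_inv]
    gcongr
    linarith
  · rw [hv p hU hV, abs_zero]; positivity

end Helpers

/-- **Symbol-type bounds** (Proposition 5.1).  If `ψ` is a finite sum of terms
`(ln r)^m r^{-n} (t/r)^k χ(ω, r/(t+1))` with `χ` smooth, supported in `{y ≥ 1/4}` and with
`∂_yχ` supported in `{y ≤ 3/4}`, where either `m ≤ M₀, n = N` or `m ≤ M, n ≥ N+1`, then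
`|∂^αψ| ≤ C_α ⟨ln r⟩^{M₀} r^{-N-|α|}` and `|Z^Iψ| ≤ C_I ⟨ln r⟩^{M₀} r^{-N}` for `t ≥ 0`,
`x ≠ 0`. -/
theorem symbol_bounds
    (K M₀ M N N' : ℕ)
    (χA : ℕ → ℕ → E3 × ℝ → ℝ) (χB : ℕ → ℕ → ℕ → E3 × ℝ → ℝ)
    (hA : ∀ k m, ContDiff ℝ (⊤:ℕ∞) (χA k m))
    (hAsupp : ∀ k m (ω : E3) (y : ℝ), y < 1/4 → χA k m (ω, y) = 0)
    (hAder : ∀ k m (ω : E3) (y : ℝ), 3/4 < y → deriv (fun s => χA k m (ω, s)) y = 0)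
    (hB : ∀ k m n, ContDiff ℝ (⊤:ℕ∞) (χB k m n))
    (hBsupp : ∀ k m n (ω : E3) (y : ℝ), y < 1/4 → χB k m n (ω, y) = 0)
    (hBder : ∀ k m n (ω : E3) (y : ℝ), 3/4 < y → deriv (fun s => χB k m n (ω, s)) y = 0)
    (ψ : Spt → ℝ)
    (hψ : ∀ p : Spt, ψ p =
      (∑ k ∈ Finset.range (K+1), ∑ m ∈ Finset.range (M₀+1),
        (Real.log ‖p.2‖)^m / ‖p.2‖^N * (p.1 / ‖p.2‖)^k
          * χA k m (omg p, ‖p.2‖ / (p.1 + 1)))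
      + ∑ k ∈ Finset.range (K+1), ∑ m ∈ Finset.range (M+1), ∑ n ∈ Finset.Icc (N+1) N',
        (Real.log ‖p.2‖)^m / ‖p.2‖^n * (p.1 / ‖p.2‖)^k
          * χB k m n (omg p, ‖p.2‖ / (p.1 + 1))) :
    (∀ (j : ℕ) (β : Fin j → Fin 4), ∃ C : ℝ, 0 < C ∧
      ∀ p : Spt, 0 ≤ p.1 → p.2 ≠ 0 →
        |pdT β ψ p| ≤ C * (1 + |Real.log ‖p.2‖|)^M₀ / ‖p.2‖^(N + j)) ∧
    (∀ (j : ℕ) (I : Fin j → ZIdx), ∃ C : ℝ, 0 < C ∧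
      ∀ p : Spt, 0 ≤ p.1 → p.2 ≠ 0 →
        |zApply I ψ p| ≤ C * (1 + |Real.log ‖p.2‖|)^M₀ / ‖p.2‖^N) := by
  have hS : Sy M₀ (-(N:ℤ)) ψ := by
    refine Sy.congr ?_ (fun p _ => hψ p)
    refine Sy.add (Sy.sum _ fun k _ => Sy.sum _ fun m hm => ?_)
      (Sy.sum _ fun k _ => Sy.sum _ fun m hm => Sy.sum _ fun n hn => ?_)
    · exact (Sy_term m N k _ (hA k m) (hAder k m)).mono (by simpa [Nat.lt_succ_iff] using hm)
    · refine (Sy_term m n k _ (hB k m n) (hBder k m n)).weak ?_ _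
      have := (Finset.mem_Icc.1 hn).1
      omega
  have hV : Van ψ := fun p hp hq => by
    have h1 : 4 * ‖p.2‖ < p.1 + 1 := by
      by_contra h
      exact hq ⟨hp, not_lt.1 h⟩
    have hy : ‖p.2‖ / (p.1 + 1) < 1/4 := by
      have := RU_r hp
      rw [div_lt_iff₀ (by linarith)]; linarith
    rw [hψ]
    simp [hAsupp _ _ _ _ hy, hBsupp _ _ _ _ _ hy]
  refine ⟨fun j β => ?_, fun j I => ?_⟩
  · obtain ⟨h1, h2⟩ := pdT_ok hS hV j β
    refine Sy_final ?_ h2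
    convert h1 using 1
    push_cast; ring
  · obtain ⟨h1, h2⟩ := zApply_ok hS hV j I
    exact Sy_final h1 h2
end
end
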